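/- Let (F, v) be a valued field with residue field F̄. Then every closed subgroup of the absolute Galois group G(F̄) is isomorphic (as a profinite group) to a closed subgroup of G(F). -/

import Mathlib

/-- The absolute Galois group `Gal(K_s/K)` of a field `K`. -/
abbrev AbsGal (K : Type) [Field K] : Type :=
  ↥(separableClosure K (AlgebraicClosure K)) ≃ₐ[K] ↥(separableClosure K (AlgebraicClosure K))

open scoped TensorProduct

section Core
variable {k K : Type*} [Field k] [Field K] [Algebra k K]

lemma core_fin {p : ℕ} [Fact p.Prime] [Algebra (ZMod p) K] {A : Type*} [AddCommGroup A]
    [Module (ZMod p) A] (y : K ⊗[ZMod p] A) :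
    ∃ S : Finset K, ∀ g : K →ₗ[ZMod p] K, (∀ s ∈ S, g s = s) →
      TensorProduct.map g LinearMap.id y = y := by
  classical
  induction y with
  | zero => exact ⟨∅, fun g _ => map_zero _⟩
  | tmul x a => exact ⟨{x}, fun g h => by simp [h x (by simp)]⟩
  | add x y hx hy =>
    obtain ⟨S, hS⟩ := hx
    obtain ⟨T, hT⟩ := hy
    refine ⟨S ∪ T, fun g h => ?_⟩
    rw [map_add, hS g (fun s hs => h s (Finset.mem_union_left _ hs)),
      hT g (fun s hs => h s (Finset.mem_union_right _ hs))]

/-- The Artin–Schreier operator. -/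
noncomputable def artSch (K : Type*) [Field K] (p : ℕ) [Fact p.Prime] [CharP K p]
    [Algebra (ZMod p) K] : K →ₗ[ZMod p] K :=
  ((frobenius K p : K →+ K).toZModLinearMap p) - LinearMap.id

lemma artSch_apply (p : ℕ) [Fact p.Prime] [CharP K p]
    [Algebra (ZMod p) K] (x : K) : artSch K p x = x ^ p - x := by
  simp [artSch, frobenius_def]

lemma artSch_surj [IsSepClosed K] (p : ℕ) [hp : Fact p.Prime] [CharP K p]
    [Algebra (ZMod p) K] : Function.Surjective (artSch K p) := by
  intro x
  obtain ⟨y, hy⟩ := IsSepClosed.exists_root_C_mul_X_pow_add_C_mul_X_add_C' (k := K) p p 1 (-1) (-x)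
    (dvd_refl _) hp.out.two_le (by simp)
  refine ⟨y, ?_⟩
  rw [artSch_apply]
  linear_combination hy

lemma artSch_exact (p : ℕ) [hp : Fact p.Prime] [CharP K p]
    [Algebra (ZMod p) K] : Function.Exact (Algebra.linearMap (ZMod p) K) (artSch K p) := by
  intro x
  rw [artSch_apply, sub_eq_zero, ← Subfield.mem_bot_iff_pow_eq_self,
    ← ZMod.fieldRange_castHom_eq_bot p]
  have : algebraMap (ZMod p) K = ZMod.castHom dvd_rfl K := Subsingleton.elim _ _
  simp [this, Algebra.linearMap_apply]

lemma core_exact [IsSepClosed K] (p : ℕ) [hp : Fact p.Prime] [CharP K p]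
    [Algebra (ZMod p) K] {A : Type*} [AddCommGroup A] [Module (ZMod p) A] (y : K ⊗[ZMod p] A)
    (h : (artSch K p).rTensor A y = 0) : ∃ a : A, y = (1 : K) ⊗ₜ a := by
  obtain ⟨z, rfl⟩ := (Module.Flat.rTensor_exact A (artSch_exact (K := K) p) y).1 h
  obtain ⟨a, rfl⟩ := (TensorProduct.lid (ZMod p) A).symm.surjective z
  exact ⟨a, by simp⟩

lemma core_inj (p : ℕ) [hp : Fact p.Prime]
    [Algebra (ZMod p) K] {A : Type*} [AddCommGroup A] [Module (ZMod p) A] (a b : A)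
    (h : (1 : K) ⊗ₜ[ZMod p] a = (1 : K) ⊗ₜ[ZMod p] b) : a = b := by
  have h1 : Function.Injective (Algebra.linearMap (ZMod p) K) := (algebraMap (ZMod p) K).injective
  have := Module.Flat.rTensor_preserves_injective_linearMap (M := A) _ h1
  have h2 : (1 : ZMod p) ⊗ₜ[ZMod p] a = (1 : ZMod p) ⊗ₜ[ZMod p] b := by
    apply this
    simpa using h
  simpa using congrArg (TensorProduct.lid (ZMod p) A) h2

theorem core [IsSepClosed K] (p : ℕ) [hp : Fact p.Prime] [CharP K p]
    {Δ E A : Type*} [Group Δ] [Group E] [AddCommGroup A] [Module (ZMod p) A]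
    (φ : Δ →* (K ≃ₐ[k] K)) (q : Δ →* E) (ι : A → E) (hι : ∀ a b, ι (a + b) = ι a * ι b)
    (hinj : Function.Injective ι) (ρ : E →* Module.End (ZMod p) A)
    (hρ : ∀ e a, ι (ρ e a) = e * ι a * e⁻¹)
    (W : Subgroup Δ) (hW : ∀ d, d ∈ W ↔ ∃ a, q d = ι a) [Fintype (Δ ⧸ W)]
    (t : Δ ⧸ W → K) (ht : ∀ d x, φ d (t x) = t (d • x)) (hsum : ∑ x, t x = 1) :
    ∃ (f : Δ → A) (S : Finset K), (∀ d e, f (d * e) = f d + ρ (q d) (f e)) ∧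
      (∀ d a, φ d = 1 → q d = ι a → f d = a) ∧
      (∀ d, q d = 1 → (∀ s ∈ S, φ d s = s) → f d = 0) := by
  classical
  let _ : Algebra (ZMod p) K := ZMod.algebra K p
  have hι0 : ι 0 = 1 := by
    have := hι 0 0
    simpa using this
  -- trivial action of A on itself
  have hρι : ∀ a, ρ (ι a) = 1 := by
    intro a
    ext b
    apply hinj
    rw [hρ, ← hι, add_comm, hι]
    simp
  -- the section function
  obtain ⟨h, hh⟩ : ∃ h : E → A, ∀ a e, h (ι a * e) = a + h e := by
    let N : Subgroup E :=
      { carrier := Set.range ι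
        mul_mem' := by
          rintro _ _ ⟨a, rfl⟩ ⟨b, rfl⟩
          exact ⟨a + b, hι a b⟩
        one_mem' := ⟨0, hι0⟩
        inv_mem' := by
          rintro _ ⟨a, rfl⟩
          refine ⟨-a, ?_⟩
          rw [eq_inv_iff_mul_eq_one, ← hι]
          simpa using hι0 }
    have : N.Normal := ⟨by
      rintro _ ⟨a, rfl⟩ e
      exact ⟨ρ e a, hρ e a⟩⟩
    have key : ∀ e : E, ∃ a, ι a = e * ((QuotientGroup.mk e : E ⧸ N).out)⁻¹ := by
      intro e
      have h1 : (QuotientGroup.mk ((QuotientGroup.mk e : E ⧸ N).out) : E ⧸ N) = QuotientGroup.mk e :=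
        Quotient.out_eq' _
      have h2 := QuotientGroup.eq.1 h1
      have h3 : e * ((QuotientGroup.mk e : E ⧸ N).out)⁻¹ ∈ N := by
        have := Subgroup.Normal.mem_comm ‹N.Normal› h2
        exact this
      exact h3
    choose h hh using key
    refine ⟨h, fun a e => hinj ?_⟩
    have h1 : (QuotientGroup.mk (ι a * e) : E ⧸ N) = QuotientGroup.mk e := by
      have : (QuotientGroup.mk (ι a) : E ⧸ N) = 1 := (QuotientGroup.eq_one_iff _).2 ⟨a, rfl⟩
      rw [QuotientGroup.mk_mul, this, one_mul]
    rw [hι, hh, hh, h1, mul_assoc]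
  have hh' : ∀ e a, h (e * ι a) = ρ e a + h e := by
    intro e a
    rw [← hh, hρ]
    simp
  let c : Δ → Δ → A := fun d e => h (q d * q e) - ρ (q d) (h (q e))
  have hc : ∀ d e w, w ∈ W → c d (e * w) = c d e := by
    intro d e w hw
    obtain ⟨a, ha⟩ := (hW w).1 hw
    simp only [c, map_mul, ha, ← mul_assoc, hh', map_add]
    simp
  let C : Δ → Δ ⧸ W → A := fun d x => c d x.out
  have hC : ∀ d e, C d (QuotientGroup.mk e) = c d e := by
    intro d e
    obtain ⟨w, hw⟩ := QuotientGroup.mk_out_eq_mul W e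
    simp only [C]
    rw [hw, hc _ _ _ w.2]
  have hCC : ∀ d d' x, C (d * d') x = C d (d' • x) + ρ (q d) (C d' x) := by
    intro d d' x
    obtain ⟨e, rfl⟩ := QuotientGroup.mk_surjective x
    rw [hC, hC, MulAction.Quotient.smul_mk, hC]
    simp only [c, smul_eq_mul, map_mul, map_sub, mul_assoc]
    simp
  have hCW : ∀ d a x, q d = ι a → C d x = a := by
    intro d a x ha
    obtain ⟨e, rfl⟩ := QuotientGroup.mk_surjective x
    rw [hC]
    simp [c, ha, hh, hρι]
  let g : Δ → (K →ₗ[ZMod p] K) := fun d => ((φ d : K ≃+ K) : K →+ K).toZModLinearMap p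
  have hg : ∀ d x, g d x = φ d x := fun d x => rfl
  let act : Δ → (K ⊗[ZMod p] A →ₗ[ZMod p] K ⊗[ZMod p] A) := fun d =>
    TensorProduct.map (g d) (ρ (q d))
  have act_mul : ∀ d e v, act (d * e) v = act d (act e v) := by
    intro d e v
    have : act (d * e) = act d ∘ₗ act e := by
      ext x a
      simp [act, hg]
    rw [this]; rfl
  let b : Δ → K ⊗[ZMod p] A := fun d => ∑ x, t (d • x) ⊗ₜ C d x
  have hb : ∀ d e, b (d * e) = b d + act d (b e) := by
    intro d e
    simp only [b, hCC, TensorProduct.tmul_add, Finset.sum_add_distrib, map_sum]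
    congr 1
    · simp only [mul_smul]
      exact (MulAction.bijective e).sum_comp (fun x => t (d • x) ⊗ₜ[ZMod p] C d x)
    · refine Finset.sum_congr rfl fun x _ => ?_
      simp [act, hg, ht, mul_smul]
  have hbW : ∀ d a, q d = ι a → b d = 1 ⊗ₜ a := by
    intro d a ha
    simp only [b, hCW d a _ ha]
    rw [← TensorProduct.sum_tmul, (MulAction.bijective d).sum_comp t, hsum]
  let P := (artSch K p).rTensor A
  have hP : ∀ d v, P (act d v) = act d (P v) := by
    intro d v
    have : P ∘ₗ act d = act d ∘ₗ P := by
      ext x a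
      simp [P, act, hg, artSch_apply]
    exact LinearMap.congr_fun this v
  have hP1 : ∀ a : A, P (1 ⊗ₜ a) = 0 := by
    intro a
    simp [P, artSch_apply]
  let β : Δ → K ⊗[ZMod p] A := fun d => P (b d)
  have hβ : ∀ d e, β (d * e) = β d + act d (β e) := by
    intro d e
    simp only [β, hb, map_add, hP]
  have hβW : ∀ d w, w ∈ W → β (d * w) = β d := by
    intro d w hw
    obtain ⟨a, ha⟩ := (hW w).1 hw
    rw [hβ]
    simp only [β, hbW w a ha, hP1, map_zero, add_zero]
  have hβo : ∀ e, β (QuotientGroup.mk e : Δ ⧸ W).out = β e := by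
    intro e
    obtain ⟨w, hw⟩ := QuotientGroup.mk_out_eq_mul W e
    rw [hw, hβW _ _ w.2]
  let x0 : K ⊗[ZMod p] A := ∑ x : Δ ⧸ W, t x • β x.out
  have act_smul : ∀ d (s : K) v, act d (s • v) = φ d s • act d v := by
    intro d s v
    induction v with
    | zero => simp
    | tmul x a => simp [act, hg, TensorProduct.smul_tmul']
    | add x y hx hy => rw [smul_add, map_add, hx, hy, map_add, smul_add]
  have hx0 : ∀ d, act d x0 = x0 - β d := by
    intro d
    have h1 : ∀ x : Δ ⧸ W, act d (t x • β x.out) = t (d • x) • β (d • x).out - t (d • x) • β d := by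
      intro x
      obtain ⟨e, rfl⟩ := QuotientGroup.mk_surjective x
      rw [act_smul, ht, MulAction.Quotient.smul_mk, hβo, hβo, smul_eq_mul, hβ, smul_add]
      exact (add_sub_cancel_left _ _).symm
    simp only [x0, map_sum, h1, Finset.sum_sub_distrib]
    rw [(MulAction.bijective d).sum_comp (fun x : Δ ⧸ W => t x • β x.out), ← Finset.sum_smul,
      (MulAction.bijective d).sum_comp t, hsum, one_smul]
  obtain ⟨y, hy⟩ : ∃ y, P y = x0 := LinearMap.rTensor_surjective A (artSch_surj (K := K) p) x0
  have key : ∀ d, ∃ a : A, b d + (act d y - y) = 1 ⊗ₜ a := by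
    intro d
    apply core_exact p
    change P _ = 0
    rw [map_add, map_sub, hP, hy, hx0]
    simp [β]
  choose f hf using key
  have actid : ∀ d, ρ (q d) = 1 → act d = TensorProduct.map (g d) LinearMap.id := by
    intro d hd
    simp only [act, hd]; rfl
  obtain ⟨S, hS⟩ := core_fin (p := p) y
  refine ⟨f, S, ?_, ?_, ?_⟩
  · intro d e
    apply core_inj (K := K) p
    have h1 : (1 : K) ⊗ₜ[ZMod p] (ρ (q d) (f e)) = act d (1 ⊗ₜ f e) := by
      simp [act, hg]
    rw [TensorProduct.tmul_add, h1, ← hf, ← hf, ← hf, hb, act_mul, map_add, map_sub]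
    abel
  · intro d a hd ha
    apply core_inj (K := K) p
    rw [← hf, hbW d a ha, actid d (by rw [ha, hρι]), hS]
    · simp
    · intro s _
      simp [hg, hd]
  · intro d hd hs
    apply core_inj (K := K) p
    rw [← hf, hbW d 0 (by rw [hd, hι0]), actid d (by rw [hd, map_one]), hS]
    · simp
    · exact hs
end Core


section P2

/-- The linear representation attached to an action on an elementary abelian group. -/
noncomputable def conjRep (p : ℕ) {Q N : Type*} [Group Q] [CommGroup N]
    [Module (ZMod p) (Additive N)] (ρ0 : Q →* MulAut N) :
    Q →* Module.End (ZMod p) (Additive N) where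
  toFun := fun e => (MonoidHom.toAdditive (ρ0 e).toMonoidHom).toZModLinearMap p
  map_one' := by
    apply LinearMap.ext; intro x
    change Additive.ofMul (ρ0 1 x.toMul) = _
    rw [map_one, Module.End.one_apply]
    rfl
  map_mul' := by
    intro x y
    apply LinearMap.ext; intro z
    rw [Module.End.mul_apply]
    change Additive.ofMul (ρ0 (x * y) z.toMul) = Additive.ofMul (ρ0 x (ρ0 y z.toMul))
    rw [map_mul]; rfl
variable {k K : Type*} [Field k] [Field K] [Algebra k K]

lemma trace_fun [IsGalois k K] {Δ : Type*} [Group Δ] [TopologicalSpace Δ] [IsTopologicalGroup Δ]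
    [CompactSpace Δ] (φ : Δ →* (K ≃ₐ[k] K)) (hφ : Continuous φ) (hs : Function.Surjective φ)
    (W : Subgroup Δ) [W.Normal] (hWo : IsOpen (W : Set Δ)) (hW : φ.ker ≤ W) [Fintype (Δ ⧸ W)] :
    ∃ t : Δ ⧸ W → K, (∀ d x, φ d (t x) = t (d • x)) ∧ ∑ x, t x = 1 := by
  classical
  have hWc : IsClosed (W : Set Δ) := W.isClosed_of_isOpen hWo
  have hcl : IsClosed ((W.map φ : Subgroup (K ≃ₐ[k] K)) : Set (K ≃ₐ[k] K)) := by
    rw [Subgroup.coe_map]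
    exact (hWc.isCompact.image hφ).isClosed
  let M : ClosedSubgroup (K ≃ₐ[k] K) := ⟨W.map φ, hcl⟩
  let k1 : IntermediateField k K := IntermediateField.fixedField (W.map φ)
  have hfix : k1.fixingSubgroup = W.map φ := InfiniteGalois.fixingSubgroup_fixedField M
  have hfi : (W.map φ).FiniteIndex := by
    have : W.FiniteIndex := Subgroup.finiteIndex_of_finite_quotient
    exact ⟨by
      rw [Subgroup.index_map_eq _ hs hW]
      exact Subgroup.FiniteIndex.index_ne_zero⟩
  have hop : IsOpen ((W.map φ : Subgroup (K ≃ₐ[k] K)) : Set (K ≃ₐ[k] K)) :=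
    Subgroup.isOpen_of_isClosed_of_finiteIndex _ hcl
  have hnorm : (W.map φ).Normal := Subgroup.Normal.map inferInstance φ hs
  obtain ⟨hfin, hgal⟩ := (InfiniteGalois.isOpen_and_normal_iff_finite_and_isGalois k1).1
    ⟨by rw [hfix]; exact hop, by rw [hfix]; exact hnorm⟩
  obtain ⟨θ, hθ⟩ := Algebra.trace_surjective k k1 1
  have hθ2 : ∑ σ : (k1 ≃ₐ[k] k1), σ θ = 1 := by
    rw [← trace_eq_sum_automorphisms, hθ, map_one]
  have hθW : ∀ w ∈ W, φ w (θ : K) = θ := fun w hw => by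
    have := θ.2
    exact this ⟨φ w, Subgroup.mem_map_of_mem _ hw⟩
  let t : Δ ⧸ W → K := fun x => φ x.out (θ : K)
  have ht : ∀ e, t (QuotientGroup.mk e) = φ e (θ : K) := by
    intro e
    obtain ⟨w, hw⟩ := QuotientGroup.mk_out_eq_mul W e
    simp only [t]
    rw [hw, map_mul, AlgEquiv.mul_apply, hθW _ w.2]
  refine ⟨t, ?_, ?_⟩
  · intro d x
    obtain ⟨e, rfl⟩ := QuotientGroup.mk_surjective x
    rw [ht, MulAction.Quotient.smul_mk, ht, smul_eq_mul, map_mul, AlgEquiv.mul_apply]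
  · let r : Δ →* (k1 ≃ₐ[k] k1) := (AlgEquiv.restrictNormalHom k1).comp φ
    have hr : ∀ d, ((r d θ : k1) : K) = φ d (θ : K) := fun d =>
      AlgEquiv.restrictNormal_commutes (φ d) k1 θ
    have hker : ∀ d, r d = 1 → d ∈ W := by
      intro d hd
      have h1 : φ d ∈ k1.fixingSubgroup := by
        rw [IntermediateField.mem_fixingSubgroup_iff]
        intro x hx
        have := AlgEquiv.restrictNormal_commutes (φ d) k1 ⟨x, hx⟩
        have h2 : (φ d).restrictNormal k1 = 1 := hd
        rw [h2] at this
        exact this.symm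
      rw [hfix] at h1
      obtain ⟨w, hw, hwd⟩ := h1
      have : w⁻¹ * d ∈ W := hW (by rw [MonoidHom.mem_ker, map_mul, map_inv, hwd]; simp)
      simpa using W.mul_mem hw this
    have hkerW : ∀ w ∈ W, r w = 1 := by
      intro w hw
      ext x
      refine (AlgEquiv.restrictNormal_commutes (φ w) k1 x).trans ?_
      have := x.2
      exact this ⟨φ w, Subgroup.mem_map_of_mem _ hw⟩
    have hrs : Function.Surjective r := by
      intro σ
      obtain ⟨τ, hτ⟩ := AlgEquiv.restrictNormalHom_surjective (F := k) (K₁ := k1) (E := K) σ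
      obtain ⟨d, hd⟩ := hs τ
      exact ⟨d, by simp only [r, MonoidHom.comp_apply, hd, hτ]⟩
    let R : Δ ⧸ W → (k1 ≃ₐ[k] k1) := QuotientGroup.lift W r (fun w hw => hkerW w hw)
    have hR : Function.Bijective R := by
      constructor
      · intro x y hxy
        obtain ⟨d, rfl⟩ := QuotientGroup.mk_surjective x
        obtain ⟨e, rfl⟩ := QuotientGroup.mk_surjective y
        rw [QuotientGroup.eq]
        apply hker
        have : r d = r e := hxy
        rw [map_mul, map_inv, this, inv_mul_cancel]
      · intro σ
        obtain ⟨d, hd⟩ := hrs σ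
        exact ⟨QuotientGroup.mk d, hd⟩
    have h3 : ∑ x : Δ ⧸ W, t x = ∑ x : Δ ⧸ W, ((R x θ : k1) : K) := by
      refine Finset.sum_congr rfl fun x _ => ?_
      obtain ⟨d, rfl⟩ := QuotientGroup.mk_surjective x
      rw [ht]
      exact (hr d).symm
    rw [h3, hR.sum_comp (fun σ : (k1 ≃ₐ[k] k1) => ((σ θ : k1) : K))]
    have := congrArg (fun x : k1 => (x : K)) hθ2
    simpa using this

theorem lemP [IsGalois k K] [IsSepClosed K] (p : ℕ) [hp : Fact p.Prime] [CharP k p]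
    {Δ : Type*} [Group Δ] [TopologicalSpace Δ] [IsTopologicalGroup Δ]
    [CompactSpace Δ] (φ : Δ →* (K ≃ₐ[k] K)) (hφ : Continuous φ) (hs : Function.Surjective φ)
    (hmin : ∀ C : Subgroup Δ, IsClosed (C : Set Δ) → (∀ γ, ∃ c ∈ C, φ c = γ) → C = ⊤)
    (U : Subgroup Δ) [U.Normal] (hU : IsOpen (U : Set Δ)) (hnot : ¬ φ.ker ≤ U)
    (hmax : ∀ V : Subgroup Δ, V.Normal → U < V → φ.ker ≤ V)
    (hpg : IsPGroup p (φ.ker.map (QuotientGroup.mk' U))) : False := by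
  classical
  have : CharP K p := charP_of_injective_algebraMap (algebraMap k K).injective p
  let q := QuotientGroup.mk' U
  have hq : Function.Surjective q := QuotientGroup.mk'_surjective U
  have hUfin : Finite (Δ ⧸ U) := Subgroup.quotient_finite_of_isOpen U hU
  let N := φ.ker.map q
  have hNn : N.Normal := Subgroup.Normal.map inferInstance q hq
  -- every nontrivial normal subgroup contains N
  have hN : ∀ M : Subgroup (Δ ⧸ U), M.Normal → M ≠ ⊥ → N ≤ M := by
    intro M hM hM1
    have h1 : U < M.comap q := by
      have h0 : U ≤ M.comap q := by
        intro u hu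
        have : q u = 1 := (QuotientGroup.eq_one_iff u).2 hu
        rw [Subgroup.mem_comap, this]; exact M.one_mem
      refine lt_of_le_of_ne h0 fun h => hM1 ?_
      rw [eq_bot_iff]
      intro x hx
      obtain ⟨d, rfl⟩ := hq x
      have : d ∈ M.comap q := hx
      rw [← h] at this
      exact (QuotientGroup.eq_one_iff d).2 this
    have := hmax _ (hM.comap q) h1
    exact Subgroup.map_le_iff_le_comap.2 this
  have hNne : N ≠ ⊥ := by
    intro h
    apply hnot
    intro d hd
    have : q d ∈ N := Subgroup.mem_map_of_mem _ hd
    rw [h] at this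
    exact (QuotientGroup.eq_one_iff d).1 this
  have hNnt : Nontrivial N := (Subgroup.nontrivial_iff_ne_bot N).2 hNne
  have hZ := IsPGroup.center_nontrivial (p := p) (G := N) hpg
  -- N is commutative
  have hcomm : ∀ x ∈ N, ∀ y ∈ N, x * y = y * x := by
    let Z := (Subgroup.center N).map N.subtype
    have hZn : Z.Normal := by
      constructor
      rintro _ ⟨z, hz, rfl⟩ g
      refine ⟨⟨g * z * g⁻¹, hNn.conj_mem _ z.2 g⟩, ?_, rfl⟩
      refine Subgroup.mem_center_iff.2 fun y => ?_
      have h1 : g⁻¹ * y * g ∈ N := by simpa using hNn.conj_mem _ y.2 g⁻¹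
      have h2 := congrArg (Subtype.val) (Subgroup.mem_center_iff.1 hz ⟨_, h1⟩)
      apply Subtype.ext
      simp only [Subgroup.coe_mul] at h2 ⊢
      calc (y : Δ ⧸ U) * (g * z * g⁻¹) = g * ((g⁻¹ * y * g) * z) * g⁻¹ := by group
        _ = g * (z * (g⁻¹ * y * g)) * g⁻¹ := by rw [h2]
        _ = _ := by group
    have hZne : Z ≠ ⊥ := by
      intro h
      obtain ⟨z, hz⟩ := exists_ne (1 : Subgroup.center N)
      apply hz
      have : ((z : N) : Δ ⧸ U) ∈ Z := ⟨z, z.2, rfl⟩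
      rw [h, Subgroup.mem_bot] at this
      exact Subtype.ext (Subtype.ext this)
    have hZN := hN Z hZn hZne
    intro x hx y hy
    obtain ⟨z, hz, rfl⟩ := hZN hx
    have := congrArg Subtype.val (Subgroup.mem_center_iff.1 hz ⟨y, hy⟩)
    exact this.symm
  -- N has exponent p
  have hexp : ∀ x ∈ N, x ^ p = 1 := by
    let T : Subgroup (Δ ⧸ U) :=
      { carrier := {x | x ∈ N ∧ x ^ p = 1}
        mul_mem' := by
          rintro a b ⟨ha, ha'⟩ ⟨hb, hb'⟩
          exact ⟨N.mul_mem ha hb, by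
            rw [(show Commute a b from hcomm a ha b hb).mul_pow, ha', hb', one_mul]⟩
        one_mem' := ⟨N.one_mem, one_pow _⟩
        inv_mem' := by
          rintro a ⟨ha, ha'⟩
          exact ⟨N.inv_mem ha, by rw [inv_pow, ha', inv_one]⟩ }
    have hTn : T.Normal := by
      constructor
      rintro x ⟨hx, hx'⟩ g
      exact ⟨hNn.conj_mem _ hx g, by rw [conj_pow, hx']; simp⟩
    have hTne : T ≠ ⊥ := by
      have hdvd : p ∣ Nat.card N := by
        obtain ⟨n, hn, hn'⟩ := hpg.nontrivial_iff_card.1 hNnt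
        rw [hn']
        exact dvd_pow_self p hn.ne'
      obtain ⟨x, hx⟩ := exists_prime_orderOf_dvd_card' p hdvd
      intro h
      have hxT : (x : Δ ⧸ U) ∈ T := ⟨x.2, by
        rw [← hx]
        exact congrArg Subtype.val (pow_orderOf_eq_one x)⟩
      rw [h, Subgroup.mem_bot] at hxT
      have : x = 1 := Subtype.ext hxT
      rw [this, orderOf_one] at hx
      exact hp.out.one_lt.ne hx
    intro x hx
    exact (hN T hTn hTne hx).2
  let _ : CommGroup N := { (inferInstance : Group N) with
    mul_comm := fun a b => Subtype.ext (hcomm a a.2 b b.2) }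
  let _ : Module (ZMod p) (Additive N) := AddCommGroup.zmodModule (n := p) (by
    intro x
    exact Subtype.ext (hexp x.toMul x.toMul.2))
  let ι : Additive N → Δ ⧸ U := fun a => (a.toMul : Δ ⧸ U)
  let ρ0 : (Δ ⧸ U) →* MulAut N := MulAut.conjNormal
  let ρ := conjRep p ρ0
  let W : Subgroup Δ := N.comap q
  have hWU : U ≤ W := by
    intro u hu
    have : q u = 1 := (QuotientGroup.eq_one_iff u).2 hu
    rw [Subgroup.mem_comap, this]; exact N.one_mem
  have hWo : IsOpen (W : Set Δ) := Subgroup.isOpen_mono hWU hU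
  have hWk : φ.ker ≤ W := fun d hd => Subgroup.mem_map_of_mem _ hd
  have hWn : W.Normal := hNn.comap q
  have hWfin : Finite (Δ ⧸ W) := Subgroup.quotient_finite_of_isOpen W hWo
  let _ := Fintype.ofFinite (Δ ⧸ W)
  obtain ⟨t, ht, hsum⟩ := trace_fun φ hφ hs W hWo hWk
  obtain ⟨f, S, hf1, hf2, hf3⟩ := core p φ q ι (fun a b => rfl)
    (fun a b h => Subtype.ext h) ρ (fun e a => rfl) W
    (fun d => ⟨fun h => ⟨Additive.ofMul ⟨q d, h⟩, rfl⟩, by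
      rintro ⟨a, ha⟩
      change q d ∈ N
      rw [ha]; exact a.toMul.2⟩) t ht hsum
  have hf10 : f 1 = 0 := by
    have := hf1 1 1
    simpa using this
  let C : Subgroup Δ :=
    { carrier := {d | f d = 0}
      mul_mem' := by
        intro a b ha hb
        change f (a * b) = 0
        rw [hf1, show f a = 0 from ha, show f b = 0 from hb]; simp
      one_mem' := hf10
      inv_mem' := by
        intro a ha
        have h1 := hf1 a⁻¹ a
        rw [inv_mul_cancel, hf10, show f a = 0 from ha] at h1
        simpa using h1.symm }
  have hCo : IsOpen (C : Set Δ) := by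
    apply C.isOpen_of_mem_nhds (g := 1)
    have h1 : ∀ s : K, φ ⁻¹' (MulAction.stabilizer (K ≃ₐ[k] K) s : Set (K ≃ₐ[k] K)) ∈ nhds (1 : Δ) := by
      intro s
      apply IsOpen.mem_nhds
      · exact (stabilizer_isOpen_of_isIntegral s).preimage hφ
      · simp
    have h2 : (⋂ s ∈ S, φ ⁻¹' (MulAction.stabilizer (K ≃ₐ[k] K) s : Set (K ≃ₐ[k] K))) ∈ nhds (1 : Δ) :=
      (Filter.biInter_finset_mem S).2 fun s _ => h1 s
    filter_upwards [h2, hU.mem_nhds U.one_mem] with d hd hdU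
    apply hf3 d ((QuotientGroup.eq_one_iff d).2 hdU)
    intro s hsS
    have := Set.mem_iInter₂.1 hd s hsS
    exact this
  have hCtop := hmin C (C.isClosed_of_isOpen hCo) (by
    intro γ
    obtain ⟨d, rfl⟩ := hs γ
    obtain ⟨i, hi, hi'⟩ := (-(f d)).toMul.2
    refine ⟨i * d, ?_, ?_⟩
    · change f (i * d) = 0
      have h1 := hf2 i (-(f d)) hi hi'
      rw [hf1, h1]
      have h2 : ρ (q i) (f d) = f d := by
        rw [hi']
        apply Additive.toMul.injective
        apply Subtype.ext
        change ((-(f d)).toMul : Δ ⧸ U) * ((f d).toMul : Δ ⧸ U) * ((-(f d)).toMul : Δ ⧸ U)⁻¹ = _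
        rw [hcomm _ (-(f d)).toMul.2 _ (f d).toMul.2]
        simp
      rw [h2]; simp
    · rw [map_mul, show φ i = 1 from hi, one_mul])
  apply hNne
  rw [eq_bot_iff]
  rintro _ ⟨i, hi, rfl⟩
  have h1 : f i = 0 := by
    have : i ∈ C := by rw [hCtop]; trivial
    exact this
  have h2 := hf2 i (Additive.ofMul ⟨q i, Subgroup.mem_map_of_mem _ hi⟩) hi rfl
  rw [h1] at h2
  exact (congrArg (fun a : Additive N => (a.toMul : Δ ⧸ U)) h2).symm

end P2


section P3

lemma val_sum_distinct {E Γ₀ ι : Type*} [Field E] [LinearOrderedCommGroupWithZero Γ₀]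
    (w : Valuation E Γ₀) (s : Finset ι) (f : ι → E)
    (h : ∀ i ∈ s, ∀ j ∈ s, i ≠ j → f i ≠ 0 → f j ≠ 0 → w (f i) ≠ w (f j)) :
    ∀ i ∈ s, w (f i) ≤ w (∑ i ∈ s, f i) := by
  classical
  intro i hi
  obtain ⟨j, hj, hmax⟩ := s.exists_max_image (fun i => w (f i)) ⟨i, hi⟩
  by_cases h0 : f j = 0
  · have := hmax i hi
    simp only [h0, map_zero] at this
    exact this.trans zero_le
  · have : w (∑ i ∈ s, f i) = w (f j) := by
      apply Valuation.map_sum_eq_of_lt _ hj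
      intro l hl
      simp only [Finset.mem_sdiff, Finset.mem_singleton] at hl
      refine lt_of_le_of_ne (hmax l hl.1) ?_
      by_cases hl0 : f l = 0
      · rw [hl0, map_zero]; exact ((map_ne_zero w).2 h0).symm
      · exact h l hl.1 j hj hl.2 hl0 h0
    rw [this]; exact hmax i hi

lemma val_alg {F E Γ₀ : Type*} [Field F] [Field E] [Algebra F E] [Algebra.IsAlgebraic F E]
    [LinearOrderedCommGroupWithZero Γ₀] (w : Valuation E Γ₀) (x : E) (hx : x ≠ 0) :
    ∃ n : ℕ, 0 < n ∧ ∃ y : F, w (x ^ n) = w (algebraMap F E y) := by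
  by_contra! hcon
  have hcon : ∀ i j : ℕ, i < j → ∀ a b : F, a ≠ 0 → b ≠ 0 →
      w (algebraMap F E a * x ^ i) ≠ w (algebraMap F E b * x ^ j) := by
    intro i j hij a b ha hb heq
    apply hcon (j - i) (by omega) (a / b)
    have hb' : algebraMap F E b ≠ 0 := by simpa using hb
    have h1 : x ^ (j - i) = (algebraMap F E b * x ^ j) / (algebraMap F E b * x ^ i) := by
      rw [mul_div_mul_left _ _ hb', pow_sub₀ _ hx hij.le, div_eq_mul_inv]
    rw [h1, map_div₀, ← heq, ← map_div₀, mul_div_mul_right _ _ (pow_ne_zero _ hx),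
      map_div₀ (algebraMap F E)]
  obtain ⟨p, hp0, hp⟩ := Algebra.IsAlgebraic.isAlgebraic (R := F) x
  have hsum : ∑ i ∈ Finset.range (p.natDegree + 1), algebraMap F E (p.coeff i) * x ^ i = 0 := by
    rw [Polynomial.aeval_eq_sum_range] at hp
    simpa [Algebra.smul_def] using hp
  have := val_sum_distinct w (Finset.range (p.natDegree + 1))
    (fun i => algebraMap F E (p.coeff i) * x ^ i) (by
      intro i _ j _ hij hi hj
      have hi' : p.coeff i ≠ 0 := by rintro h; simp [h] at hi
      have hj' : p.coeff j ≠ 0 := by rintro h; simp [h] at hj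
      rcases lt_or_gt_of_ne hij with h | h
      · exact hcon i j h _ _ hi' hj'
      · exact (hcon j i h _ _ hj' hi').symm) p.natDegree (by simp)
  rw [hsum, map_zero, le_zero_iff, map_eq_zero] at this
  simp [hx, hp0] at this

lemma val_frob {E Γ₀ : Type*} [Field E] [LinearOrderedCommGroupWithZero Γ₀]
    (w : Valuation E Γ₀) (l : ℕ) (hl : l.Prime) (hwl : w l < 1) (t : E) (ht : w t ≤ 1)
    (h : w (t ^ l - 1) < 1) : w (t - 1) < 1 := by
  have h1 : w (t - 1) ≤ 1 := (w.map_sub _ _).trans (by simp [ht])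
  obtain ⟨r, hr⟩ := exists_add_pow_prime_eq hl (⟨t - 1, h1⟩ : w.integer) 1
  have hr' : (t - 1 + 1) ^ l = (t - 1) ^ l + 1 ^ l + l * ((t - 1) * (r : E)) := by
    simpa [mul_assoc] using congrArg (fun z : w.integer => (z : E)) hr
  have h2 : (t - 1) ^ l = (t ^ l - 1) - l * ((t - 1) * r) := by
    rw [sub_add_cancel, one_pow] at hr'
    rw [hr']; ring
  have h3 : w ((t - 1) ^ l) < 1 := by
    rw [h2]
    refine lt_of_le_of_lt (w.map_sub _ _) (max_lt h ?_)
    rw [map_mul]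
    exact mul_lt_one_of_lt_of_le hwl (by rw [map_mul]; exact mul_le_one' h1 r.2)
  rw [map_pow] at h3
  exact (pow_lt_one_iff hl.ne_zero).1 h3

lemma val_frob' {E Γ₀ : Type*} [Field E] [LinearOrderedCommGroupWithZero Γ₀]
    (w : Valuation E Γ₀) (t : E) (ht : w t ≤ 1) (m : ℕ) (hm : 0 < m)
    (hwl : ∀ l : ℕ, l.Prime → l ∣ m → w l < 1)
    (h : w (t ^ m - 1) < 1) : w (t - 1) < 1 := by
  induction m using Nat.strong_induction_on with
  | _ m ih =>
    by_cases h1 : m = 1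
    · simpa [h1] using h
    · obtain ⟨l, hl, m', rfl⟩ := Nat.exists_prime_and_dvd h1
      have hm' : 0 < m' := Nat.pos_of_mul_pos_left hm
      refine ih m' ?_ hm' (fun q hq hqm => hwl q hq (hqm.mul_left _)) ?_
      · have := hl.two_le; nlinarith
      · apply val_frob w l hl (hwl l hl (dvd_mul_right _ _)) _ (by rw [map_pow]; exact pow_le_one' ht _)
        rw [← pow_mul, mul_comm]; exact h

variable {k K F E Γ₀ : Type*} [Field k] [Field K] [Algebra k K] [Field F] [Field E] [Algebra F E]
  [IsGalois F E] [LinearOrderedCommGroupWithZero Γ₀]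

lemma claim_pow [IsSepClosed E] (w : Valuation E Γ₀) (D : Subgroup (E ≃ₐ[F] E))
    (hD : IsClosed (D : Set (E ≃ₐ[F] E)))
    (R0 : ∀ d ∈ D, ∀ x, w (d x) = w x)
    (R2 : ∀ C : Subgroup (E ≃ₐ[F] E), IsClosed (C : Set (E ≃ₐ[F] E)) → C ≤ D →
      (∀ x, w x ≤ 1 → (∀ c ∈ C, c x = x) → ∀ d ∈ D, w (d x - x) < 1) → C = D)
    (l : ℕ) (hl : l.Prime) (hwl : w l = 1) (a : E) (ha0 : a ≠ 0)
    (ha : a ∈ IntermediateField.fixedField D) :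
    ∃ c ∈ IntermediateField.fixedField D, w (c ^ l) = w a := by
  by_contra! hcon
  have : NeZero (l : E) := ⟨by rintro h; rw [h, map_zero] at hwl; exact zero_ne_one hwl⟩
  obtain ⟨α, hα⟩ := IsSepClosed.exists_pow_nat_eq a l
  have hα0 : α ≠ 0 := by rintro rfl; rw [zero_pow hl.ne_zero] at hα; exact ha0 hα.symm
  set L := IntermediateField.fixedField D with hLdef
  have hLD : L.fixingSubgroup = D :=
    InfiniteGalois.fixingSubgroup_fixedField (⟨D, hD⟩ : ClosedSubgroup (E ≃ₐ[F] E))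
  have key : ∀ m : ℕ, 0 < m → m < l → ∀ c ∈ L, w (α ^ m) ≠ w c := by
    intro m hm hml c hc heq
    have hcop : Nat.Coprime m l :=
      ((Nat.Prime.coprime_iff_not_dvd hl).2 (fun h => by have := Nat.le_of_dvd hm h; omega)).symm
    obtain ⟨s, -, hs⟩ := Nat.exists_mul_mod_eq_one_of_coprime hcop hl.one_lt
    have hs' : m * s = l * (m * s / l) + 1 := by
      conv_rhs => rw [← hs]
      exact (Nat.div_add_mod _ _).symm
    generalize m * s / l = t at hs'
    apply hcon (c ^ s / a ^ t) (L.div_mem (pow_mem hc _) (pow_mem ha _))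
    have h1 : w α = w (c ^ s / a ^ t) := by
      have h2 : w (α ^ (m * s)) = w (c ^ s) := by
        rw [pow_mul, map_pow, heq, map_pow]
      have h3 : α ^ (m * s) = a ^ t * α := by rw [hs', pow_succ, pow_mul, hα]
      rw [map_div₀, ← h2, h3, map_mul, mul_div_cancel_left₀]
      simp [ha0]
    rw [map_pow, ← h1, ← map_pow, hα]
  let C : Subgroup (E ≃ₐ[F] E) := D ⊓ MulAction.stabilizer (E ≃ₐ[F] E) α
  have hCD : C = D := by
    refine R2 C ?_ inf_le_left ?_
    · exact hD.inter (Subgroup.isClosed_of_isOpen _ (stabilizer_isOpen_of_isIntegral α))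
    · intro x hx hxC d hd
      have hxM : x ∈ (IntermediateField.adjoin L {α}).restrictScalars F := by
        rw [← InfiniteGalois.fixedField_fixingSubgroup
          ((IntermediateField.adjoin L {α}).restrictScalars F),
          IntermediateField.mem_fixedField_iff]
        intro σ hσ
        rw [IntermediateField.mem_fixingSubgroup_iff] at hσ
        apply hxC
        refine ⟨?_, ?_⟩
        · rw [← hLD]
          change σ ∈ L.fixingSubgroup
          rw [IntermediateField.mem_fixingSubgroup_iff]
          intro y hy
          exact hσ y ((IntermediateField.adjoin L {α}).algebraMap_mem ⟨y, hy⟩)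
        · exact hσ α (IntermediateField.mem_adjoin_simple_self L α)
      have hαint : IsAlgebraic L α := 
        (Algebra.IsAlgebraic.isAlgebraic (R := F) α).tower_top L
      rw [IntermediateField.mem_restrictScalars, ← IntermediateField.mem_toSubalgebra,
        IntermediateField.adjoin_simple_toSubalgebra_of_isAlgebraic hαint,
        Algebra.adjoin_singleton_eq_range_aeval] at hxM
      obtain ⟨P, hP⟩ := hxM
      let a' : L := ⟨a, ha⟩
      let M : Polynomial L := Polynomial.X ^ l - Polynomial.C a'
      have hM : M.Monic := Polynomial.monic_X_pow_sub_C a' hl.ne_zero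
      let R := P %ₘ M
      have hR : R.natDegree < l := by
        have := Polynomial.natDegree_modByMonic_lt P hM (by
          intro h
          have := Polynomial.natDegree_X_pow_sub_C (n := l) (r := a')
          rw [show Polynomial.X ^ l - Polynomial.C a' = 1 from h] at this
          simp at this; exact hl.ne_zero this.symm)
        rwa [Polynomial.natDegree_X_pow_sub_C] at this
      have hRx : Polynomial.aeval α R = x := by
        have h1 := Polynomial.modByMonic_add_div P M
        have h2 := congrArg (Polynomial.aeval α) h1
        have h3 : Polynomial.aeval α M = 0 := by
          simp only [M, map_sub, map_pow, Polynomial.aeval_X, Polynomial.aeval_C, hα]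
          exact sub_self a
        rw [map_add, map_mul, h3, zero_mul, add_zero] at h2
        rw [h2]; exact hP
      have hsum : ∑ i ∈ Finset.range l, (R.coeff i : E) * α ^ i = x := by
        rw [← hRx, Polynomial.aeval_eq_sum_range' hR]
        rfl
      have hle := val_sum_distinct w (Finset.range l) (fun i => (R.coeff i : E) * α ^ i) (by
        have h0 : ∀ i j : ℕ, i < j → j < l → (R.coeff i : E) ≠ 0 → (R.coeff j : E) ≠ 0 →
            w ((R.coeff i : E) * α ^ i) ≠ w ((R.coeff j : E) * α ^ j) := by
          intro i j hij hj hi0 hj0 heq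
          apply key (j - i) (by omega) (by omega) ((R.coeff i : E) / R.coeff j)
            (L.div_mem (R.coeff i).2 (R.coeff j).2)
          have h1 : α ^ (j - i) = ((R.coeff j : E) * α ^ j) / ((R.coeff j : E) * α ^ i) := by
            rw [mul_div_mul_left _ _ hj0, pow_sub₀ _ hα0 hij.le, div_eq_mul_inv]
          rw [h1, map_div₀, ← heq, ← map_div₀, mul_div_mul_right _ _ (pow_ne_zero _ hα0)]
        intro i hi j hj hij hi0 hj0
        rcases lt_or_gt_of_ne hij with h | h
        · exact h0 i j h (Finset.mem_range.1 hj) (left_ne_zero_of_mul hi0) (left_ne_zero_of_mul hj0)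
        · exact (h0 j i h (Finset.mem_range.1 hi) (left_ne_zero_of_mul hj0)
            (left_ne_zero_of_mul hi0)).symm)
      rw [hsum] at hle
      have hlt : ∀ i ∈ Finset.range l \ {0}, w ((R.coeff i : E) * α ^ i) < 1 := by
        intro i hi
        simp only [Finset.mem_sdiff, Finset.mem_singleton, Finset.mem_range] at hi
        refine lt_of_le_of_ne ((hle i (Finset.mem_range.2 hi.1)).trans hx) ?_
        intro h1
        apply key i (by omega) hi.1 ((R.coeff i : E)⁻¹) (L.inv_mem (R.coeff i).2)
        rw [map_mul] at h1
        rw [map_inv₀]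
        exact eq_inv_of_mul_eq_one_right h1
      have hy : w (x - R.coeff 0) < 1 := by
        have : x - R.coeff 0 = ∑ i ∈ Finset.range l \ {0}, (R.coeff i : E) * α ^ i := by
          have := Finset.sum_sdiff (f := fun i => (R.coeff i : E) * α ^ i)
            (show ({0} : Finset ℕ) ⊆ Finset.range l by simpa using hl.pos)
          rw [← hsum, ← this]
          simp
        rw [this]
        exact w.map_sum_lt one_ne_zero hlt
      have hfix : d (R.coeff 0 : E) = R.coeff 0 :=
        (IntermediateField.mem_fixedField_iff D _).1 (R.coeff 0).2 d hd
      have : d x - x = d (x - R.coeff 0) - (x - R.coeff 0) := by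
        rw [map_sub, hfix]; ring
      rw [this]
      exact lt_of_le_of_lt (w.map_sub _ _) (max_lt (by rw [R0 d hd]; exact hy) hy)
  apply hcon α ?_ (by rw [hα])
  rw [hLdef, IntermediateField.mem_fixedField_iff]
  intro f hf
  rw [← hCD] at hf
  exact hf.2

end P3


section P4

lemma charP_of_prime_zero {k : Type*} [Field k] {p : ℕ} (hp : p.Prime) (h : (p : k) = 0) :
    CharP k p := by
  obtain ⟨q, hq⟩ := CharP.exists k
  have h1 := (CharP.cast_eq_zero_iff k q p).1 h
  rcases (Nat.dvd_prime hp).1 h1 with h2 | h2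
  · subst h2
    have := (CharP.cast_eq_zero_iff k 1 1).2 dvd_rfl
    rw [Nat.cast_one] at this
    exact absurd this one_ne_zero
  · rwa [← h2]
variable {k K F E Γ₀ : Type*} [Field k] [Field K] [Algebra k K] [Field F] [Field E] [Algebra F E]
  [IsGalois F E] [LinearOrderedCommGroupWithZero Γ₀]

lemma claim_root (w : Valuation E Γ₀) (L : IntermediateField F E)
    (hL : ∀ l : ℕ, l.Prime → ¬ w l < 1 → ∀ a ∈ L, a ≠ 0 → ∃ c ∈ L, w (c ^ l) = w a)
    (x : E) (hx : x ≠ 0) : ∃ m : ℕ, 0 < m ∧ (∀ l : ℕ, l.Prime → l ∣ m → w l < 1) ∧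
      ∃ c ∈ L, w (x ^ m) = w c := by
  obtain ⟨n, hn, y, hy⟩ := val_alg (F := F) w x hx
  have gen : ∀ n : ℕ, 0 < n → ∀ y ∈ L, w (x ^ n) = w y →
      ∃ m : ℕ, 0 < m ∧ (∀ l : ℕ, l.Prime → l ∣ m → w l < 1) ∧ ∃ c ∈ L, w (x ^ m) = w c := by
    intro n
    induction n using Nat.strong_induction_on with
    | _ n ih =>
      intro hn y hy hxy
      by_cases h : ∀ l : ℕ, l.Prime → l ∣ n → w l < 1
      · exact ⟨n, hn, h, y, hy, hxy⟩
      · push Not at h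
        obtain ⟨l, hl, ⟨n', rfl⟩, hwl⟩ := h
        have hy0 : y ≠ 0 := by
          rintro rfl
          rw [map_zero, map_eq_zero] at hxy
          exact pow_ne_zero _ hx hxy
        obtain ⟨c, hc, hcy⟩ := hL l hl (not_lt.2 hwl) y hy hy0
        have hn' : 0 < n' := Nat.pos_of_mul_pos_left hn
        refine ih n' (by have := hl.two_le; nlinarith) hn' c hc ?_
        have h1 : (w (x ^ n')) ^ l = (w c) ^ l := by
          rw [← map_pow, ← map_pow, hcy, ← hxy, ← pow_mul, mul_comm]
        exact (pow_left_inj₀ zero_le zero_le hl.ne_zero).1 h1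
  exact gen n hn _ (L.algebraMap_mem y) hy

lemma claim_wild (w : Valuation E Γ₀) (L : IntermediateField F E) (σ : E ≃ₐ[F] E)
    (hσL : ∀ x ∈ L, σ x = x) (R0 : ∀ x, w (σ x) = w x)
    (R1 : ∀ x, w x ≤ 1 → w (σ x - x) < 1)
    (hL : ∀ l : ℕ, l.Prime → ¬ w l < 1 → ∀ a ∈ L, a ≠ 0 → ∃ c ∈ L, w (c ^ l) = w a)
    (x : E) (hx : x ≠ 0) : w (σ x - x) < w x := by
  obtain ⟨m, hm, hml, c, hc, hxc⟩ := claim_root w L hL x hx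
  have hwx : w x ≠ 0 := (map_ne_zero w).2 hx
  have hc0 : c ≠ 0 := by
    rintro rfl
    rw [map_zero, map_eq_zero] at hxc
    exact pow_ne_zero _ hx hxc
  have hwc : w c ≠ 0 := (map_ne_zero w).2 hc0
  have h1 : w (σ x / x) = 1 := by rw [map_div₀, R0, div_self hwx]
  have hu : w (x ^ m / c) = 1 := by rw [map_div₀, hxc, div_self hwc]
  have h2 : w ((σ x / x) ^ m - 1) < 1 := by
    have h3 := R1 _ hu.le
    have h4 : σ (x ^ m / c) - x ^ m / c = ((σ x / x) ^ m - 1) * (x ^ m / c) := by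
      rw [map_div₀, map_pow, hσL c hc, div_pow]
      have := pow_ne_zero m hx
      field_simp
    rw [h4, map_mul, hu, mul_one] at h3
    exact h3
  have h3 := val_frob' w (σ x / x) h1.le m hm hml h2
  have h4 : σ x - x = (σ x / x - 1) * x := by field_simp
  rw [h4, map_mul]
  exact mul_lt_of_lt_one_left (zero_lt_iff.2 hwx) h3

lemma claim_tame (w : Valuation E Γ₀) (σ : E ≃ₐ[F] E) (l : ℕ) (hwl : w l = 1)
    (hσ : ∀ i : ℕ, ∀ x : E, x ≠ 0 → w ((σ ^ i) x - x) < w x)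
    (x : E) (hx : (σ ^ l) x = x) : σ x = x := by
  have hl0 : (l : E) ≠ 0 := by rintro h; rw [h, map_zero] at hwl; exact zero_ne_one hwl
  set T := ∑ i ∈ Finset.range l, (σ ^ i) x with hT
  have hσT : σ T = T := by
    have h1 : σ T = ∑ i ∈ Finset.range l, (σ ^ (i + 1)) x := by
      rw [hT, map_sum]
      refine Finset.sum_congr rfl fun i _ => ?_
      rw [pow_succ']; rfl
    have h2 := Finset.sum_range_succ (fun i => (σ ^ i) x) l
    rw [Finset.sum_range_succ'] at h2
    rw [h1, hT]
    simp only [hx, pow_zero, AlgEquiv.one_apply] at h2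
    exact add_right_cancel h2
  have hσT' : ∀ i : ℕ, (σ ^ i) T = T := by
    intro i
    induction i with
    | zero => simp
    | succ n ih => rw [pow_succ', AlgEquiv.mul_apply, ih, hσT]
  set z := l * x - T with hz
  by_cases hz0 : z = 0
  · have h1 : (l : E) * x = T := by rw [hz] at hz0; exact sub_eq_zero.1 hz0
    have h2 : σ (l * x) = l * x := by rw [h1, hσT]
    rw [map_mul, map_natCast] at h2
    exact mul_left_cancel₀ hl0 h2
  · exfalso
    have h1 : ∑ i ∈ Finset.range l, (σ ^ i) z = 0 := by
      have : ∀ i ∈ Finset.range l, (σ ^ i) z = l * (σ ^ i) x - T := by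
        intro i _
        rw [hz, map_sub, map_mul, map_natCast, hσT']
      rw [Finset.sum_congr rfl this, Finset.sum_sub_distrib, ← Finset.mul_sum]
      simp [hT]
    have h2 : w (∑ i ∈ Finset.range l, ((σ ^ i) z - z)) < w z :=
      w.map_sum_lt ((map_ne_zero w).2 hz0) fun i _ => hσ i z hz0
    have h3 : ∑ i ∈ Finset.range l, ((σ ^ i) z - z) = - (l * z) := by
      rw [Finset.sum_sub_distrib, h1]; simp
    rw [h3, Valuation.map_neg, map_mul, hwl, one_mul] at h2
    exact lt_irrefl _ h2

theorem lemM1 [IsSepClosed E] [IsGalois k K] [IsSepClosed K]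
    (w : Valuation E Γ₀) (D : Subgroup (E ≃ₐ[F] E))
    (hD : IsClosed (D : Set (E ≃ₐ[F] E)))
    (φ : D →* (K ≃ₐ[k] K)) (hφ : Continuous φ) (hs : Function.Surjective φ)
    (R0 : ∀ d ∈ D, ∀ x, w (d x) = w x)
    (R1 : ∀ d : D, φ d = 1 → ∀ x, w x ≤ 1 → w ((d : E ≃ₐ[F] E) x - x) < 1)
    (R2 : ∀ C : Subgroup (E ≃ₐ[F] E), IsClosed (C : Set (E ≃ₐ[F] E)) → C ≤ D →
      (∀ x, w x ≤ 1 → (∀ c ∈ C, c x = x) → ∀ d ∈ D, w (d x - x) < 1) →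
      ∀ γ, ∃ d : D, (d : E ≃ₐ[F] E) ∈ C ∧ φ d = γ)
    (R3 : ∀ n : ℕ, w n < 1 ↔ (n : k) = 0)
    (hmin : ∀ C : Subgroup D, IsClosed (C : Set D) → (∀ γ, ∃ c ∈ C, φ c = γ) → C = ⊤) :
    Function.Injective φ := by
  classical
  have hcD : CompactSpace D := isCompact_iff_compactSpace.1 hD.isCompact
  rw [injective_iff_map_eq_one]
  by_contra! hne
  obtain ⟨d0, hd0, hd0ne⟩ := hne
  have hwn : ∀ n : ℕ, w n ≤ 1 := fun n => by
    have := natCast_mem w.integer n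
    exact this
  let L := IntermediateField.fixedField D
  have hL : ∀ l : ℕ, l.Prime → ¬ w l < 1 → ∀ a ∈ L, a ≠ 0 → ∃ c ∈ L, w (c ^ l) = w a := by
    intro l hl hwl a ha ha0
    refine claim_pow w D hD R0 ?_ l hl (le_antisymm (hwn l) (not_lt.1 hwl)) a ha0 ha
    intro C hC hCD hx
    have h1 := R2 C hC hCD hx
    have h2 := hmin (C.subgroupOf D) (hC.preimage continuous_subtype_val) (by
      intro γ
      obtain ⟨d, hd, hd'⟩ := h1 γ
      exact ⟨d, hd, hd'⟩)
    exact le_antisymm hCD (Subgroup.subgroupOf_eq_top.1 h2)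
  have hwild : ∀ d : D, φ d = 1 → ∀ x : E, x ≠ 0 → w ((d : E ≃ₐ[F] E) x - x) < w x := by
    intro d hd x hx
    exact claim_wild w L d (fun x hx => (IntermediateField.mem_fixedField_iff D _).1 hx d d.2)
      (R0 d d.2) (R1 d hd) hL x hx
  have hex : ∃ n : ℕ, ∃ U : Subgroup D, U.Normal ∧ IsOpen (U : Set D) ∧ ¬ φ.ker ≤ U ∧
      U.index = n := by
    obtain ⟨H0, hH0⟩ := ProfiniteGrp.exist_openNormalSubgroup_sub_open_nhds_of_one
      (G := D) (U := {d0}ᶜ) isOpen_compl_singleton (by simpa using hd0ne.symm)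
    refine ⟨_, H0.toSubgroup, inferInstance, H0.isOpen', ?_, rfl⟩
    intro h
    exact hH0 (h hd0) rfl
  obtain ⟨U, hUn, hUo, hUk, hUi⟩ := Nat.find_spec hex
  have hmax : ∀ V : Subgroup D, V.Normal → U < V → φ.ker ≤ V := by
    intro V hV hUV
    by_contra hVk
    have hfin : Finite (D ⧸ U) := Subgroup.quotient_finite_of_isOpen U hUo
    have : U.FiniteIndex := Subgroup.finiteIndex_of_finite_quotient
    have hlt : V.index < U.index := Subgroup.index_strictAnti hUV
    rw [hUi] at hlt
    exact Nat.find_min hex hlt ⟨V, hV, Subgroup.isOpen_mono hUV.le hUo, hVk, rfl⟩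
  have hUfin : Finite (D ⧸ U) := Subgroup.quotient_finite_of_isOpen U hUo
  let N := φ.ker.map (QuotientGroup.mk' U)
  have hl : ∀ l : ℕ, l.Prime → l ∣ Nat.card N → (l : k) = 0 := by
    intro l hlp hdvd
    by_contra hlk
    have hwl : w l = 1 := le_antisymm (hwn l) (not_lt.1 fun h => hlk ((R3 l).1 h))
    have : Fact l.Prime := ⟨hlp⟩
    obtain ⟨⟨n, σ, hσ, rfl⟩, hord⟩ := exists_prime_orderOf_dvd_card' (G := N) l hdvd
    have hσl : σ ^ l ∈ U := by
      rw [← QuotientGroup.eq_one_iff]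
      have := pow_orderOf_eq_one (⟨QuotientGroup.mk' U σ, σ, hσ, rfl⟩ : N)
      rw [hord] at this
      exact congrArg Subtype.val this
    have hσU : σ ∉ U := by
      intro h
      have h1 : (⟨QuotientGroup.mk' U σ, σ, hσ, rfl⟩ : N) = 1 :=
        Subtype.ext ((QuotientGroup.eq_one_iff σ).2 h)
      rw [h1, orderOf_one] at hord
      exact hlp.one_lt.ne hord
    have hU'c : IsClosed ((U.map D.subtype : Subgroup (E ≃ₐ[F] E)) : Set (E ≃ₐ[F] E)) := by
      rw [Subgroup.coe_map]
      exact ((U.isClosed_of_isOpen hUo).isCompact.image continuous_subtype_val).isClosed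
    have hU' := InfiniteGalois.fixingSubgroup_fixedField
      (⟨U.map D.subtype, hU'c⟩ : ClosedSubgroup (E ≃ₐ[F] E))
    apply hσU
    have h1 : (σ : E ≃ₐ[F] E) ∈ U.map D.subtype := by
      change _ = U.map D.subtype at hU'
      rw [← hU', IntermediateField.mem_fixingSubgroup_iff]
      intro x hx
      have hx' := (IntermediateField.mem_fixedField_iff _ _).1 hx
      apply claim_tame w (σ : E ≃ₐ[F] E) l hwl
      · intro i x hx
        exact hwild (σ ^ i) (by rw [map_pow, show φ σ = 1 from hσ, one_pow]) x hx
      · exact hx' _ ⟨σ ^ l, hσl, rfl⟩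
    obtain ⟨u, hu, hu'⟩ := h1
    have : u = σ := Subtype.ext hu'
    rwa [← this]
  have hNcard : Nat.card N ≠ 1 := by
    intro h
    apply hUk
    intro d hd
    have : Subsingleton N := (Nat.card_eq_one_iff_unique.1 h).1
    have h1 : (⟨QuotientGroup.mk' U d, d, hd, rfl⟩ : N) = 1 := Subsingleton.elim _ _
    exact (QuotientGroup.eq_one_iff d).1 (congrArg Subtype.val h1)
  obtain ⟨p, hp, hpN⟩ := Nat.exists_prime_and_dvd hNcard
  have hpF : Fact p.Prime := ⟨hp⟩
  have hchar : CharP k p := charP_of_prime_zero hp (hl p hp hpN)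
  have hpg : IsPGroup p N := IsPGroup.of_card (Nat.eq_prime_pow_of_unique_prime_dvd
    (p := p) Nat.card_pos.ne' (by
      intro q hq hqN
      exact (((Nat.prime_dvd_prime_iff_eq hp hq).1 ((CharP.cast_eq_zero_iff k p q).1 (hl q hq hqN)))).symm))
  exact lemP p φ hφ hs hmin U hUo hUk hmax hpg


theorem exists_min {G H : Type*} [Group G] [TopologicalSpace G] [IsTopologicalGroup G]
    [CompactSpace G] [T2Space G]
    [Group H] [TopologicalSpace H] [T1Space H] (φ : G →* H) (hφ : Continuous φ)
    (hs : Function.Surjective φ) :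
    ∃ D : Subgroup G, IsClosed (D : Set G) ∧ (∀ γ, ∃ d ∈ D, φ d = γ) ∧
      ∀ C : Subgroup G, IsClosed (C : Set G) → C ≤ D → (∀ γ, ∃ d ∈ C, φ d = γ) → C = D := by
  let S : Set (Set G) := {s | ∃ D : Subgroup G, (D : Set G) = s ∧ IsClosed s ∧
    ∀ γ, ∃ d ∈ D, φ d = γ}
  obtain ⟨m, -, hm⟩ := zorn_superset_nonempty S (by
    intro c hcS hc hcn
    refine ⟨⋂₀ c, ?_, fun s hs => Set.sInter_subset_of_mem hs⟩
    let T : Set (Subgroup G) := {D | (D : Set G) ∈ c}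
    have hT : ((sInf T : Subgroup G) : Set G) = ⋂₀ c := by
      ext x
      rw [SetLike.mem_coe, Subgroup.mem_sInf, Set.mem_sInter]
      constructor
      · intro h s hs
        obtain ⟨D, rfl, -⟩ := hcS hs
        exact h D hs
      · intro h D hD
        exact h _ hD
    refine ⟨sInf T, hT, isClosed_sInter fun s hs => ?_, ?_⟩
    · obtain ⟨D, -, h, -⟩ := hcS hs
      exact h
    · intro γ
      let c' : Set (Set G) := (fun s => s ∩ φ ⁻¹' {γ}) '' c
      have hfib : IsClosed (φ ⁻¹' {γ}) := isClosed_singleton.preimage hφ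
      have hc'n : Nonempty c' := (hcn.image _).to_subtype
      have hcl : ∀ U ∈ c', IsClosed U := by
        rintro _ ⟨s, hs, rfl⟩
        obtain ⟨D, -, h, -⟩ := hcS hs
        exact h.inter hfib
      have hne := IsCompact.nonempty_sInter_of_directed_nonempty_isCompact_isClosed
        (S := c') (by
          rintro _ ⟨s, hs, rfl⟩ _ ⟨t, ht, rfl⟩
          rcases hc.total hs ht with h | h
          · exact ⟨_, ⟨s, hs, rfl⟩, subset_rfl, Set.inter_subset_inter_left _ h⟩
          · exact ⟨_, ⟨t, ht, rfl⟩, Set.inter_subset_inter_left _ h, subset_rfl⟩)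
        (by
          rintro _ ⟨s, hs, rfl⟩
          obtain ⟨D, rfl, -, h⟩ := hcS hs
          obtain ⟨d, hd, hd'⟩ := h γ
          exact ⟨d, hd, hd'⟩)
        (fun U hU => (hcl U hU).isCompact) hcl
      obtain ⟨x, hx⟩ := hne
      rw [Set.mem_sInter] at hx
      obtain ⟨s, hs⟩ := hcn
      refine ⟨x, ?_, (hx _ ⟨s, hs, rfl⟩).2⟩
      rw [← SetLike.mem_coe, hT, Set.mem_sInter]
      intro t ht
      exact (hx _ ⟨t, ht, rfl⟩).1) Set.univ ⟨⊤, rfl, isClosed_univ, fun γ => by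
        obtain ⟨d, hd⟩ := hs γ
        exact ⟨d, trivial, hd⟩⟩
  obtain ⟨D, rfl, hD, hDs⟩ := hm.1
  refine ⟨D, hD, hDs, ?_⟩
  intro C hC hCD hCs
  exact le_antisymm hCD (hm.2 ⟨C, rfl, hC, hCs⟩ hCD)

theorem lemM [IsSepClosed E] [IsGalois k K] [IsSepClosed K]
    (w : Valuation E Γ₀) (D : Subgroup (E ≃ₐ[F] E))
    (hD : IsClosed (D : Set (E ≃ₐ[F] E)))
    (φ : D →* (K ≃ₐ[k] K)) (hφ : Continuous φ) (hs : Function.Surjective φ)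
    (R0 : ∀ d ∈ D, ∀ x, w (d x) = w x)
    (R1 : ∀ d : D, φ d = 1 → ∀ x, w x ≤ 1 → w ((d : E ≃ₐ[F] E) x - x) < 1)
    (R2 : ∀ C : Subgroup (E ≃ₐ[F] E), IsClosed (C : Set (E ≃ₐ[F] E)) → C ≤ D →
      (∀ x, w x ≤ 1 → (∀ c ∈ C, c x = x) → ∀ γ, ∃ d : D, φ d = γ ∧
        w ((d : E ≃ₐ[F] E) x - x) < 1) →
      ∀ γ, ∃ d : D, (d : E ≃ₐ[F] E) ∈ C ∧ φ d = γ)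
    (R3 : ∀ n : ℕ, w n < 1 ↔ (n : k) = 0) :
    ∃ ψ : (K ≃ₐ[k] K) →* (E ≃ₐ[F] E), Continuous ψ ∧ Function.Injective ψ := by
  have hcD : CompactSpace D := isCompact_iff_compactSpace.1 hD.isCompact
  obtain ⟨M, hM, hMs, hMmin⟩ := exists_min φ hφ hs
  let D' : Subgroup (E ≃ₐ[F] E) := M.map D.subtype
  have hD'D : D' ≤ D := by rintro _ ⟨d, -, rfl⟩; exact d.2
  have hD' : IsClosed (D' : Set (E ≃ₐ[F] E)) := by
    rw [Subgroup.coe_map]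
    exact (hM.isCompact.image continuous_subtype_val).isClosed
  have hcD' : CompactSpace D' := isCompact_iff_compactSpace.1 hD'.isCompact
  let φ' : D' →* (K ≃ₐ[k] K) := φ.comp (Subgroup.inclusion hD'D)
  have hφ' : Continuous φ' := hφ.comp (continuous_inclusion hD'D)
  have hs' : Function.Surjective φ' := by
    intro γ
    obtain ⟨d, hd, rfl⟩ := hMs γ
    exact ⟨⟨d, d, hd, rfl⟩, rfl⟩
  have hinj : Function.Injective φ' := by
    refine lemM1 w D' hD' φ' hφ' hs' (fun d hd => R0 d (hD'D hd))
      (fun d hd => R1 (Subgroup.inclusion hD'D d) hd) ?_ R3 ?_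
    · intro C hC hCD' hx γ
      obtain ⟨d, hd, hd'⟩ := R2 C hC (hCD'.trans hD'D) (by
        intro x hx1 hxC γ
        obtain ⟨d, rfl⟩ := hs' γ
        exact ⟨Subgroup.inclusion hD'D d, rfl, hx x hx1 hxC d d.2⟩) γ
      exact ⟨⟨d, hCD' hd⟩, hd, hd'⟩
    · intro C hC hCs
      have h1 := hMmin ((C.map D'.subtype).subgroupOf D) (by
          have : IsClosed ((C.map D'.subtype : Subgroup (E ≃ₐ[F] E)) : Set (E ≃ₐ[F] E)) := by
            rw [Subgroup.coe_map]
            exact (hC.isCompact.image continuous_subtype_val).isClosed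
          exact this.preimage continuous_subtype_val) (by
          rintro d ⟨c, -, hc⟩
          obtain ⟨m, hm, hm'⟩ := c.2
          have : m = d := Subtype.ext (hm'.trans hc)
          rwa [← this]) (by
          intro γ
          obtain ⟨c, hc, hc'⟩ := hCs γ
          exact ⟨Subgroup.inclusion hD'D c, ⟨c, hc, rfl⟩, hc'⟩)
      rw [eq_top_iff]
      rintro ⟨_, m, hm, rfl⟩ -
      rw [SetLike.mem_coe, ← h1] at hm
      obtain ⟨c, hc, hc'⟩ := hm
      have : c = ⟨_, m, (by rw [SetLike.mem_coe, ← h1]; exact ⟨c, hc, hc'⟩), rfl⟩ := Subtype.ext hc'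
      rwa [← this]
  let e : D' ≃* (K ≃ₐ[k] K) := MulEquiv.ofBijective φ' ⟨hinj, hs'⟩
  have hec : Continuous e.symm := by
    have := Continuous.continuous_symm_of_equiv_compact_to_t2 (f := e.toEquiv) hφ'
    exact this
  exact ⟨D'.subtype.comp e.symm.toMonoidHom, continuous_subtype_val.comp hec,
    Subtype.val_injective.comp e.symm.injective⟩

end P4


section P5

lemma exists_dvd_all {O : Type*} [CommRing O] [IsDomain O] [ValuationRing O] {ι : Type*}
    (s : Finset ι) (hs : s.Nonempty) (c : ι → O) : ∃ i ∈ s, ∀ j ∈ s, c i ∣ c j := by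
  classical
  induction hs using Finset.Nonempty.cons_induction with
  | singleton a => exact ⟨a, by simp, by simp⟩
  | cons a s ha hs ih =>
    obtain ⟨i, hi, h⟩ := ih
    rcases ValuationRing.dvd_total (c a) (c i) with h1 | h1
    · refine ⟨a, by simp, ?_⟩
      intro j hj
      rcases Finset.mem_cons.1 hj with rfl | hj
      · exact dvd_rfl
      · exact h1.trans (h j hj)
    · refine ⟨i, by simp [hi], ?_⟩
      intro j hj
      rcases Finset.mem_cons.1 hj with rfl | hj
      · exact h1
      · exact h j hj

variable {O F E : Type*} [CommRing O] [IsDomain O] [ValuationRing O] [Field F] [Field E]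
  [Algebra O F] [IsFractionRing O F] [Algebra F E] [Algebra O E] [IsScalarTower O F E]

lemma exists_prim_poly [Algebra.IsAlgebraic F E] (x : E) :
    ∃ q : Polynomial O, Polynomial.aeval x q = 0 ∧ ∃ i, IsUnit (q.coeff i) := by
  have : Algebra.IsAlgebraic O E := (IsFractionRing.comap_isAlgebraic_iff (A := O) (K := F)).2 ‹_›
  obtain ⟨p, hp, hx⟩ := Algebra.IsAlgebraic.isAlgebraic (R := O) x
  have hinj : Function.Injective (algebraMap O E) := by
    rw [IsScalarTower.algebraMap_eq O F E]
    exact (algebraMap F E).injective.comp (IsFractionRing.injective O F)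
  obtain ⟨i, hi, h⟩ := exists_dvd_all p.support (Polynomial.support_nonempty.2 hp) p.coeff
  have hC : Polynomial.C (p.coeff i) ∣ p := by
    rw [Polynomial.C_dvd_iff_dvd_coeff]
    intro j
    by_cases hj : j ∈ p.support
    · exact h j hj
    · rw [Polynomial.notMem_support_iff.1 hj]; exact dvd_zero _
  obtain ⟨q, hq⟩ := hC
  have hi0 : p.coeff i ≠ 0 := Polynomial.mem_support_iff.1 hi
  refine ⟨q, ?_, i, ?_⟩
  · have h1 := hx
    rw [hq, map_mul, Polynomial.aeval_C] at h1
    rcases mul_eq_zero.1 h1 with h2 | h2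
    · exact absurd ((map_eq_zero_iff _ hinj).1 h2) hi0
    · exact h2
  · have h1 : p.coeff i = p.coeff i * q.coeff i := by
      conv_lhs => rw [hq, Polynomial.coeff_C_mul]
    have h2 : q.coeff i = 1 := by
      apply mul_left_cancel₀ hi0; rw [← h1, mul_one]
    rw [h2]; exact isUnit_one

lemma lem_a [Algebra.IsAlgebraic F E] (w : ValuationSubring E)
    (hw : ∀ a : O, w.valuation (algebraMap O E a) ≤ 1)
    (hloc : ∀ a : O, ¬ IsUnit a → w.valuation (algebraMap O E a) < 1)
    (x : E) (hx : x ∈ w) :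
    ∃ y : E, IsIntegral O y ∧ IsIntegral O (x * y) ∧ w.valuation y = 1 := by
  classical
  by_cases hx0 : x = 0
  · exact ⟨1, isIntegral_one, by rw [hx0, zero_mul]; exact isIntegral_zero, map_one _⟩
  obtain ⟨q, hq, i, hi⟩ := exists_prim_poly (O := O) (F := F) x
  have hP : ∃ j, IsUnit (q.coeff j) ∧ ∀ m, j < m → ¬ IsUnit (q.coeff m) := by
    refine ⟨Nat.findGreatest (fun j => IsUnit (q.coeff j)) q.natDegree, ?_, ?_⟩
    · refine Nat.findGreatest_spec (P := fun j => IsUnit (q.coeff j)) (m := i) ?_ hi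
      exact Polynomial.le_natDegree_of_ne_zero hi.ne_zero
    · intro m hm hu
      exact Nat.findGreatest_is_greatest hm
        (Polynomial.le_natDegree_of_ne_zero hu.ne_zero) hu
  obtain ⟨j, hj, hjm⟩ := hP
  set N := q.natDegree + 1 with hN
  set a : ℕ → E := fun n => algebraMap O E (q.coeff n) with ha
  set y : E := ∑ m ∈ Finset.range N, a (j + m) * x ^ m with hy
  have hsum : ∑ n ∈ Finset.range j, a n * x ^ n + x ^ j * y = 0 := by
    have h1 : Polynomial.aeval x q = ∑ n ∈ Finset.range (j + N), a n * x ^ n := by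
      rw [Polynomial.aeval_def, Polynomial.eval₂_eq_sum_range' _ (n := j + N) (by omega)]
    rw [hq, Finset.sum_range_add] at h1
    rw [h1, hy, Finset.mul_sum]
    congr 1
    apply Finset.sum_congr rfl
    intro m _
    rw [pow_add]; ring
  have hy2 : y = - ∑ n ∈ Finset.range j, a n * (x⁻¹) ^ (j - n) := by
    apply mul_left_cancel₀ (pow_ne_zero j hx0)
    rw [eq_neg_of_add_eq_zero_right hsum, mul_neg, Finset.mul_sum]
    congr 1
    apply Finset.sum_congr rfl
    intro n hn
    have hn := (Finset.mem_range.1 hn).le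
    have : x ^ j = x ^ n * x ^ (j - n) := by rw [← pow_add]; congr 1; omega
    rw [this, inv_pow]
    field_simp
  have hz2 : x * y = - ∑ n ∈ Finset.range j, a n * (x⁻¹) ^ (j - n - 1) := by
    rw [hy2, mul_neg, Finset.mul_sum]
    congr 1
    apply Finset.sum_congr rfl
    intro n hn
    have hn := (Finset.mem_range.1 hn)
    have : j - n = (j - n - 1) + 1 := by omega
    rw [this, pow_succ]
    simp only [Nat.add_sub_cancel]
    field_simp
  have hB : ∀ V : ValuationSubring E, (integralClosure O E).toSubring ≤ V.toSubring →
      ∀ n, a n ∈ V := fun V hV n => hV (isIntegral_algebraMap)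
  have yint : IsIntegral O y := by
    by_contra hc
    have hc' : y ∉ (integralClosure O E).toSubring := hc
    obtain ⟨V, hV, hyV⟩ := Subring.exists_le_valuationSubring_of_isIntegrallyClosedIn hc'
    rcases V.mem_or_inv_mem x with h | h
    · exact hyV (sum_mem fun m _ => mul_mem (hB V hV _) (pow_mem h _))
    · apply hyV
      rw [hy2]
      exact neg_mem (sum_mem fun m _ => mul_mem (hB V hV _) (pow_mem h _))
  refine ⟨y, yint, ?_, ?_⟩
  · by_contra hc
    have hc' : x * y ∉ (integralClosure O E).toSubring := hc
    obtain ⟨V, hV, hyV⟩ := Subring.exists_le_valuationSubring_of_isIntegrallyClosedIn hc'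
    rcases V.mem_or_inv_mem x with h | h
    · exact hyV (mul_mem h (hV yint))
    · apply hyV
      rw [hz2]
      exact neg_mem (sum_mem fun m _ => mul_mem (hB V hV _) (pow_mem h _))
  · rw [hy, hN, Finset.sum_range_succ']
    have hxv : w.valuation x ≤ 1 := (w.valuation_le_one_iff x).2 hx
    have h1 : w.valuation (∑ m ∈ Finset.range q.natDegree, a (j + (m + 1)) * x ^ (m + 1)) < 1 := by
      apply Valuation.map_sum_lt _ one_ne_zero
      intro m _
      rw [map_mul, map_pow]
      exact mul_lt_one_of_lt_of_le (hloc _ (hjm _ (by omega))) (pow_le_one' hxv _)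
    have h2 : w.valuation (a j) = 1 := by
      apply le_antisymm (hw _)
      obtain ⟨u, hu⟩ := hj.exists_right_inv
      have : w.valuation (a j) * w.valuation (algebraMap O E u) = 1 := by
        rw [← map_mul, ha, ← map_mul, hu, map_one, map_one]
      calc (1 : _) = w.valuation (a j) * w.valuation (algebraMap O E u) := this.symm
        _ ≤ w.valuation (a j) * 1 := by gcongr; exact hw _
        _ = _ := mul_one _
    rw [add_zero, pow_zero, mul_one, Valuation.map_add_eq_of_lt_right _ (by rw [h2]; exact h1), h2]

end P5


section P6
variable {O F E κ : Type*} [CommRing O] [Field F] [Field E]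
  [Algebra O F] [Algebra F E] [Algebra O E] [IsScalarTower O F E] [Field κ]

lemma lemS [IsGalois F E] (π : integralClosure O E →+* κ) (hπ : Function.Surjective π)
    (C : Subgroup (E ≃ₐ[F] E)) (hC : IsClosed (C : Set (E ≃ₐ[F] E)))
    (τ : κ ≃+* κ)
    (h : ∀ b : integralClosure O E, (∀ c ∈ C, c (b : E) = b) → τ (π b) = π b) :
    ∃ c ∈ C, ∀ b b' : integralClosure O E, (b' : E) = c b → τ (π b) = π b' := by
  have : SMulCommClass (E ≃ₐ[F] E) O E := ⟨fun g o e => by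
    rw [AlgEquiv.smul_def, AlgEquiv.smul_def, ← algebraMap_smul F o e,
      ← algebraMap_smul F o (g e), map_smul]⟩
  have : CompactSpace C := isCompact_iff_compactSpace.1 hC.isCompact
  let : TopologicalSpace (integralClosure O E) := ⊥
  have : DiscreteTopology (integralClosure O E) := ⟨rfl⟩
  have : SMulCommClass C O (integralClosure O E) := ⟨fun g o e => Subtype.ext (by
    change (g : E ≃ₐ[F] E) • (o • (e : E)) = o • ((g : E ≃ₐ[F] E) • (e : E))
    exact smul_comm _ _ _)⟩
  have : ContinuousSMul C (integralClosure O E) := by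
    rw [continuousSMul_iff_stabilizer_isOpen]
    intro b
    have h1 := stabilizer_isOpen_of_isIntegral (K := F) (b : E)
    have h2 := h1.preimage (continuous_subtype_val (p := fun g => g ∈ C))
    convert h2 using 1
    ext g
    exact Subtype.ext_iff
  let A := FixedPoints.subalgebra O (integralClosure O E) C
  have : Algebra.IsInvariant A (integralClosure O E) C := ⟨fun b hb => ⟨⟨b, hb⟩, rfl⟩⟩
  have : SMulCommClass C A (integralClosure O E) := ⟨fun g a e => by
    rw [Algebra.smul_def, Algebra.smul_def, smul_mul']
    congr 1
    exact a.2 g⟩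
  let Q := RingHom.ker π
  have : Q.IsPrime := RingHom.ker_isPrime π
  let ε : (integralClosure O E ⧸ Q) ≃+* κ := RingHom.quotientKerEquivOfSurjective hπ
  have hε : ∀ b, ε (Ideal.Quotient.mk Q b) = π b := fun b => rfl
  let P := Q.under A
  let σ : (integralClosure O E ⧸ Q) ≃ₐ[A ⧸ P] (integralClosure O E ⧸ Q) :=
    AlgEquiv.ofRingEquiv (f := (ε.trans τ).trans ε.symm) (by
      intro x
      obtain ⟨a, rfl⟩ := Ideal.Quotient.mk_surjective x
      change ε.symm (τ (ε (Ideal.Quotient.mk Q a.1))) = Ideal.Quotient.mk Q a.1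
      rw [RingEquiv.symm_apply_eq, hε]
      apply h
      intro c hc
      exact congrArg Subtype.val (a.2 ⟨c, hc⟩))
  obtain ⟨c, hc⟩ := Ideal.Quotient.stabilizerHom_surjective_of_profinite (G := C) P Q σ
  refine ⟨c.1, c.1.2, ?_⟩
  intro b b' hbb
  have h1 := congrArg (fun f => ε (f (Ideal.Quotient.mk Q b))) hc
  have h2 : b' = c.1 • b := Subtype.ext hbb
  have h3 : ε (Ideal.Quotient.mk Q b') = ε (ε.symm (τ (ε (Ideal.Quotient.mk Q b)))) := by
    rw [h2]; exact h1
  rw [RingEquiv.apply_symm_apply, hε, hε] at h3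
  exact h3.symm
end P6


section P7
set_option linter.unusedSectionVars false
open IsLocalRing Polynomial

lemma sepClosed_residue {E : Type*} [Field E] [IsSepClosed E] (w : ValuationSubring E) :
    IsSepClosed (ResidueField w) := by
  apply IsSepClosed.of_exists_root
  intro p hp hirr hsep
  obtain ⟨P, hP, hdeg, hmon⟩ := lifts_and_natDegree_eq_and_monic (f := residue w) (p := p)
    (by rw [lifts_iff_coeff_lifts]; intro n; exact residue_surjective _) hp
  have hres : IsUnit (resultant P (derivative P)) := by
    rw [separable_def, ← isUnit_resultant_iff_isCoprime hp] at hsep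
    have h1 := resultant_map_map P (derivative P) P.natDegree (derivative P).natDegree (residue w)
    rw [← derivative_map, hP] at h1
    have h2 : (derivative p).natDegree ≤ (derivative P).natDegree := by
      rw [← hP, derivative_map]; exact natDegree_map_le
    obtain ⟨j, hj⟩ := Nat.exists_eq_add_of_le h2
    rw [hj, hdeg, resultant_add_right_deg _ _ _ _ _ le_rfl, hp.coeff_natDegree, one_pow, one_mul,
      ← hdeg, ← hj] at h1
    rw [hdeg] at h1
    rw [← hdeg] at h1
    have h3 : residue w (resultant P (derivative P)) ≠ 0 := by
      rw [← h1, hdeg]; exact hsep.ne_zero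
    rwa [residue_ne_zero_iff_isUnit] at h3
  rw [isUnit_resultant_iff_isCoprime hmon] at hres
  have hs : (P.map (algebraMap w E)).Separable := Separable.map (p := P) hres
  have hd : (P.map (algebraMap w E)).degree ≠ 0 := by
    rw [hmon.degree_map, degree_eq_natDegree hmon.ne_zero, hdeg]
    exact_mod_cast hirr.natDegree_pos.ne'
  obtain ⟨x, hx⟩ := IsSepClosed.exists_root _ hd hs
  have hxi : IsIntegral w x := ⟨P, hmon, by rwa [IsRoot, eval_map] at hx⟩
  obtain ⟨y, rfl⟩ := IsIntegrallyClosed.isIntegral_iff.1 hxi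
  refine ⟨residue w y, ?_⟩
  rw [← hP, eval_map, eval₂_hom]
  rw [IsRoot, eval_map, eval₂_hom] at hx
  have : P.eval y = 0 := (IsFractionRing.injective w E) (by rw [hx, map_zero])
  rw [this, map_zero]

variable {O F E : Type*} [CommRing O] [IsDomain O] [ValuationRing O] [Field F] [Field E]
  [Algebra O F] [IsFractionRing O F] [Algebra F E] [Algebra O E] [IsScalarTower O F E]
  (w : ValuationSubring E) [Algebra O w] [IsScalarTower O w E] [IsLocalHom (algebraMap O w)]

lemma hw_le (a : O) : w.valuation (algebraMap O E a) ≤ 1 := by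
  rw [IsScalarTower.algebraMap_apply O w E]
  exact w.valuation_le_one _

lemma hw_lt (a : O) (ha : ¬ IsUnit a) : w.valuation (algebraMap O E a) < 1 := by
  rw [IsScalarTower.algebraMap_apply O w E]
  refine (w.valuation_lt_one_iff _).1 ?_
  rw [mem_maximalIdeal]
  intro h
  exact ha (isUnit_of_map_unit _ _ h)

lemma int_mem {b : E} (hb : IsIntegral O b) : b ∈ w := by
  have hb' : IsIntegral w b := hb.tower_top
  obtain ⟨y, rfl⟩ := IsIntegrallyClosed.isIntegral_iff.1 hb'
  exact y.2

/-- reduction of integral elements -/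
noncomputable def piB : integralClosure O E →+* ResidueField w :=
  (residue w).comp ((algebraMap (integralClosure O E) E).codRestrict w (fun b => int_mem w b.2))

lemma piB_apply (b : integralClosure O E) : piB w b = residue w ⟨b, int_mem w b.2⟩ := rfl

lemma residue_eq_zero_iff_val (x : w) : residue w x = 0 ↔ w.valuation (x : E) < 1 := by
  rw [residue_eq_zero_iff, w.valuation_lt_one_iff]

lemma piB_surj [Algebra.IsAlgebraic F E] : Function.Surjective (piB (O := O) w) := by
  intro t
  obtain ⟨x, rfl⟩ := residue_surjective t
  obtain ⟨y, hy, hxy, hv⟩ := lem_a (O := O) (F := F) w (hw_le w) (hw_lt w) x x.2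
  let Q := RingHom.ker (piB (O := O) w)
  have : Q.IsPrime := RingHom.ker_isPrime _
  have hmax : Q.IsMaximal := by
    apply Ideal.isMaximal_of_isIntegral_of_isMaximal_comap (R := O)
    have : Q.comap (algebraMap O (integralClosure O E)) = maximalIdeal O := by
      ext a
      change residue w _ = 0 ↔ _
      rw [residue_eq_zero_iff_val, mem_maximalIdeal]
      constructor
      · intro h hu
        have h1 := hu.map (algebraMap O w)
        have h2 : w.valuation (algebraMap w E (algebraMap O w a)) = 1 :=
          (w.valuation_eq_one_iff _).1 h1
        rw [← IsScalarTower.algebraMap_apply O w E] at h2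
        exact h.ne h2
      · intro h
        exact hw_lt w a h
    rw [this]
    exact maximalIdeal.isMaximal O
  let y' : integralClosure O E := ⟨y, hy⟩
  have hy' : y' ∉ Q := by
    intro h
    have h1 : residue w _ = 0 := h
    rw [residue_eq_zero_iff_val] at h1
    exact h1.ne hv
  obtain ⟨z, i, hi, h1⟩ := hmax.exists_inv hy'
  refine ⟨z * ⟨_, hxy⟩, ?_⟩
  have h2 : piB w (⟨_, hxy⟩ : integralClosure O E) = residue w x * piB w y' := by
    rw [piB_apply, piB_apply, ← map_mul]
    rfl
  have h3 : piB w (z * y') = 1 := by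
    have := congrArg (piB (O := O) w) h1
    rwa [map_add, (hi : piB w i = 0), add_zero, map_one] at this
  rw [map_mul, h2, mul_comm, mul_assoc, mul_comm (piB w y'), ← map_mul, h3, mul_one]

lemma normal_residue [Normal F E] : Normal (ResidueField O) (ResidueField w) := by
  have key : ∀ t : ResidueField w, ∃ p : O[X], p.Monic ∧
      aeval t (p.map (residue O)) = 0 ∧ (p.map (algebraMap O (ResidueField w))).Splits := by
    intro t
    obtain ⟨b, rfl⟩ := piB_surj (O := O) (F := F) w t
    have hb : IsIntegral O (b : E) := b.2
    have hmon : (minpoly O (b : E)).Monic := minpoly.monic hb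
    refine ⟨minpoly O (b : E), hmon, ?_, ?_⟩
    · have h1 : aeval (⟨(b : E), int_mem w b.2⟩ : w) (minpoly O (b : E)) = 0 := by
        apply IsFractionRing.injective w E
        rw [map_zero, ← aeval_algebraMap_apply]
        exact minpoly.aeval O (b : E)
      rw [← ResidueField.algebraMap_eq, aeval_map_algebraMap, piB_apply,
        ← ResidueField.algebraMap_eq, aeval_algebraMap_apply, h1, map_zero]
    · rw [IsScalarTower.algebraMap_eq O w (ResidueField w), ← Polynomial.map_map]
      apply Splits.map
      have h0 := Normal.splits (F := F) (K := E) inferInstance (b : E)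
      have h2 := minpoly.isIntegrallyClosed_eq_field_fractions F E (R := O) (S := E) hb
      rw [Algebra.algebraMap_self_apply] at h2
      rw [h2, Polynomial.map_map, ← IsScalarTower.algebraMap_eq] at h0
      apply Splits.of_splits_map_of_injective (i := algebraMap w E) (IsFractionRing.injective w E)
      · rwa [Polynomial.map_map, ← IsScalarTower.algebraMap_eq O w E]
      · intro a ha
        rw [Polynomial.map_map, ← IsScalarTower.algebraMap_eq O w E] at ha
        have h3 := (mem_roots'.1 ha).2
        rw [IsRoot, eval_map] at h3
        exact ⟨⟨a, int_mem (O := O) w ⟨_, hmon, h3⟩⟩, rfl⟩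
  rw [normal_iff]
  intro t
  obtain ⟨p, hp, hr, hs⟩ := key t
  refine ⟨⟨p.map (residue O), hp.map _, hr⟩, ?_⟩
  have hd : minpoly (ResidueField O) t ∣ p.map (residue O) := minpoly.dvd _ _ hr
  have hne : (p.map (residue O)).map (algebraMap (ResidueField O) (ResidueField w)) ≠ 0 :=
    ((hp.map _).map _).ne_zero
  refine Splits.of_dvd ?_ hne (Polynomial.map_dvd _ hd)
  rwa [Polynomial.map_map, ← ResidueField.algebraMap_eq, ← IsScalarTower.algebraMap_eq]

end P7


section P8
set_option linter.unusedSectionVars false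
open IsLocalRing Polynomial
open scoped Pointwise

variable {O F E : Type*} [CommRing O] [IsDomain O] [ValuationRing O] [Field F] [Field E]
  [Algebra O F] [IsFractionRing O F] [Algebra F E] [Algebra O E] [IsScalarTower O F E]
  (w : ValuationSubring E) [Algebra O w] [IsScalarTower O w E] [IsLocalHom (algebraMap O w)]

lemma mem_decomp_iff (d : E ≃ₐ[F] E) :
    d ∈ w.decompositionSubgroup F ↔ ∀ x, d x ∈ w ↔ x ∈ w := by
  rw [ValuationSubring.decompositionSubgroup, MulAction.mem_stabilizer_iff, SetLike.ext_iff]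
  constructor
  · intro h x
    rw [← h (d x)]
    exact ValuationSubring.smul_mem_pointwise_smul_iff (g := d)
  · intro h x
    obtain ⟨y, rfl⟩ := d.surjective x
    rw [h y]
    exact ValuationSubring.smul_mem_pointwise_smul_iff (g := d)

lemma decomp_closed [Algebra.IsAlgebraic F E] :
    IsClosed ((w.decompositionSubgroup F : Subgroup (E ≃ₐ[F] E)) : Set (E ≃ₐ[F] E)) := by
  have h : ((w.decompositionSubgroup F : Subgroup (E ≃ₐ[F] E)) : Set (E ≃ₐ[F] E)) =
      ⋂ x : E, {d | d x ∈ w ↔ x ∈ w} := by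
    ext d
    rw [SetLike.mem_coe, mem_decomp_iff, Set.mem_iInter]
    rfl
  rw [h]
  apply isClosed_iInter
  intro x
  rw [← isOpen_compl_iff, isOpen_iff_mem_nhds]
  intro d hd
  have h1 := stabilizer_isOpen_of_isIntegral (K := F) x
  have h2 : IsOpen ((fun g : E ≃ₐ[F] E => d⁻¹ * g) ⁻¹'
      (MulAction.stabilizer (E ≃ₐ[F] E) x : Set (E ≃ₐ[F] E))) :=
    h1.preimage (continuous_const_mul _)
  refine Filter.mem_of_superset (h2.mem_nhds ?_) ?_
  · change d⁻¹ * d ∈ MulAction.stabilizer (E ≃ₐ[F] E) x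
    rw [inv_mul_cancel]; exact one_mem _
  · intro g hg
    have hg : (d⁻¹ * g) • x = x := hg
    rw [mul_smul, inv_smul_eq_iff] at hg
    have hg : g x = d x := hg
    change ¬ (g x ∈ w ↔ x ∈ w)
    rw [hg]
    exact hd

lemma decomp_val [Algebra.IsAlgebraic F E] (d : E ≃ₐ[F] E) (hd : d ∈ w.decompositionSubgroup F)
    (x : E) : w.valuation (d x) = w.valuation x := by
  rw [mem_decomp_iff] at hd
  by_cases hx : x = 0
  · rw [hx, map_zero]
  have hle : ∀ a b : E, b ≠ 0 → w.valuation a ≤ w.valuation b →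
      w.valuation (d a) ≤ w.valuation (d b) := by
    intro a b hb h
    have hb' : d b ≠ 0 := by simpa using hb
    have h1 : a / b ∈ w := by
      rw [← w.valuation_le_one_iff, map_div₀]
      exact div_le_one_of_le₀ h zero_le
    rw [← hd, ← w.valuation_le_one_iff, map_div₀, map_div₀] at h1
    have hb2 : w.valuation (d b) ≠ 0 := (Valuation.ne_zero_iff _).2 hb'
    rwa [div_le_one₀ (zero_lt_iff.2 hb2)] at h1
  obtain ⟨n, hn, y, hy⟩ := val_alg (F := F) w.valuation x hx
  have hxn : x ^ n ≠ 0 := pow_ne_zero _ hx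
  have hy0 : algebraMap F E y ≠ 0 := by
    intro h
    rw [h, map_zero, Valuation.zero_iff] at hy
    exact hxn hy
  have h2 := le_antisymm (hle _ _ hy0 hy.le) (hle _ _ hxn hy.ge)
  rw [AlgEquiv.commutes, ← hy, map_pow, map_pow, map_pow] at h2
  exact (pow_left_inj₀ zero_le zero_le hn.ne').1 h2

/-- action on the residue field -/
noncomputable instance decomp_smulComm :
    SMulCommClass (w.decompositionSubgroup F) (ResidueField O) (ResidueField w) := ⟨by
  intro d a t
  obtain ⟨a, rfl⟩ := residue_surjective a
  obtain ⟨t, rfl⟩ := residue_surjective t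
  rw [Algebra.smul_def, Algebra.smul_def, smul_mul']
  congr 1
  change residue w (d • (algebraMap O w a)) = residue w (algebraMap O w a)
  congr 1
  apply Subtype.ext
  change (d : E ≃ₐ[F] E) (algebraMap w E (algebraMap O w a)) = algebraMap w E (algebraMap O w a)
  rw [← IsScalarTower.algebraMap_apply O w E, IsScalarTower.algebraMap_apply O F E,
    AlgEquiv.commutes]⟩

/-- the action map -/
noncomputable def actD : (w.decompositionSubgroup F) →*
    (ResidueField w ≃ₐ[ResidueField O] ResidueField w) :=
  MulSemiringAction.toAlgAut (w.decompositionSubgroup F) (ResidueField O) (ResidueField w)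

lemma actD_residue (d : w.decompositionSubgroup F) (x : w) (h : (d : E ≃ₐ[F] E) x ∈ w) :
    actD (O := O) w d (residue w x) = residue w ⟨(d : E ≃ₐ[F] E) x, h⟩ := rfl

lemma conj_integral (c : E ≃ₐ[F] E) {b : E} (hb : IsIntegral O b) : IsIntegral O (c b) := by
  have := hb.map (c.toAlgHom.restrictScalars O)
  exact this

lemma lemS' [IsGalois F E] (C : Subgroup (E ≃ₐ[F] E)) (hC : IsClosed (C : Set (E ≃ₐ[F] E)))
    (τ : ResidueField w ≃ₐ[ResidueField O] ResidueField w)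
    (h : ∀ b : integralClosure O E, (∀ c ∈ C, c (b : E) = b) → τ (piB w b) = piB w b) :
    ∃ d : w.decompositionSubgroup F, (d : E ≃ₐ[F] E) ∈ C ∧ actD w d = τ := by
  have hsurj := piB_surj (O := O) (F := F) w
  obtain ⟨c, hcC, hc⟩ := lemS (F := F) (piB w) hsurj C hC τ.toRingEquiv h
  have hc : ∀ b b' : integralClosure O E, (b' : E) = c b → τ (piB w b) = piB w b' := hc
  have pres : ∀ (c : E ≃ₐ[F] E) (τ : ResidueField w ≃ₐ[ResidueField O] ResidueField w),
      (∀ b b' : integralClosure O E, (b' : E) = c b → τ (piB w b) = piB w b') →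
      ∀ x ∈ w, c x ∈ w := by
    intro c τ hc x hx
    obtain ⟨y, hy, hxy, hv⟩ := lem_a (O := O) (F := F) w (hw_le w) (hw_lt w) x hx
    have h1 := hc ⟨y, hy⟩ ⟨c y, conj_integral c hy⟩ rfl
    have h2 : piB w (⟨y, hy⟩ : integralClosure O E) ≠ 0 := by
      rw [piB_apply, Ne, residue_eq_zero_iff_val]
      exact hv.not_lt
    have h3 : piB w (⟨c y, conj_integral c hy⟩ : integralClosure O E) ≠ 0 := by
      rw [← h1]; simpa using h2
    rw [piB_apply, Ne, residue_eq_zero_iff_val, not_lt] at h3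
    have h4 : w.valuation (c (x * y)) ≤ 1 :=
      (w.valuation_le_one_iff _).2 (int_mem w (conj_integral c hxy))
    rw [← w.valuation_le_one_iff]
    rw [map_mul, map_mul] at h4
    refine le_trans ?_ h4
    exact le_mul_of_one_le_right' h3
  have hcinv : ∀ b b' : integralClosure O E, (b' : E) = c⁻¹ b → τ⁻¹ (piB w b) = piB w b' := by
    intro b b' hb
    have h1 : (b : E) = c b' := by rw [hb]; exact (c.apply_symm_apply _).symm
    rw [← hc b' b h1]
    exact τ.symm_apply_apply _
  have hcD : c ∈ w.decompositionSubgroup F := by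
    rw [mem_decomp_iff]
    intro x
    refine ⟨fun h => ?_, pres c τ hc x⟩
    have := pres c⁻¹ τ⁻¹ hcinv _ h
    rwa [show c⁻¹ (c x) = x from c.symm_apply_apply x] at this
  refine ⟨⟨c, hcD⟩, hcC, ?_⟩
  ext t
  obtain ⟨b, rfl⟩ := hsurj t
  rw [hc b ⟨c b, conj_integral c b.2⟩ rfl]
  rfl

end P8


section P9
set_option linter.unusedSectionVars false
open IsLocalRing Polynomial
open scoped Pointwise

variable {O F E : Type*} [CommRing O] [IsDomain O] [ValuationRing O] [Field F] [Field E]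
  [Algebra O F] [IsFractionRing O F] [Algebra F E] [Algebra O E] [IsScalarTower O F E]

theorem mainM
  (w : ValuationSubring E) [Algebra O w] [IsScalarTower O w E] [IsLocalHom (algebraMap O w)]
    [IsGalois F E] [IsSepClosed E] {K : Type*} [Field K] [Algebra (ResidueField O) K]
    [IsGalois (ResidueField O) K] [IsSepClosed K] :
    ∃ ψ : (K ≃ₐ[ResidueField O] K) →* (E ≃ₐ[F] E), Continuous ψ ∧ Function.Injective ψ := by
  have : IsSepClosed (ResidueField w) := sepClosed_residue w
  have hnorm : Normal (ResidueField O) (ResidueField w) := normal_residue (F := F) w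
  let ι : K →ₐ[ResidueField O] ResidueField w := IsSepClosed.lift
  let _ : Algebra K (ResidueField w) := ι.toAlgebra
  have : IsScalarTower (ResidueField O) K (ResidueField w) := IsScalarTower.of_algHom ι
  have : Algebra.IsAlgebraic K (ResidueField w) :=
    Algebra.IsAlgebraic.tower_top (K := ResidueField O) K
  have : IsPurelyInseparable K (ResidueField w) := inferInstance
  let ρ : (ResidueField w ≃ₐ[ResidueField O] ResidueField w) →* (K ≃ₐ[ResidueField O] K) :=
    AlgEquiv.restrictNormalHom K
  have hρs : Function.Surjective ρ := AlgEquiv.restrictNormalHom_surjective (ResidueField w)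
  have hρc : ∀ τ x, algebraMap K (ResidueField w) (ρ τ x) = τ (algebraMap K (ResidueField w) x) :=
    fun τ x => AlgEquiv.restrictNormal_commutes τ K x
  have hρi : Function.Injective ρ := by
    intro τ τ' h
    have h1 : (τ : ResidueField w →+* ResidueField w) = τ' := by
      apply IsPurelyInseparable.injective_comp_algebraMap K (ResidueField w) (ResidueField w)
      ext x
      change τ (algebraMap K (ResidueField w) x) = τ' (algebraMap K (ResidueField w) x)
      rw [← hρc, ← hρc, h]
    ext t
    exact congrArg (fun f => f t) h1
  let D := w.decompositionSubgroup F
  let φ : D →* (K ≃ₐ[ResidueField O] K) := ρ.comp (actD w)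
  have hφ : ∀ d τ, φ d = ρ τ ↔ actD w d = τ := fun d τ => hρi.eq_iff
  have hsurj := piB_surj (O := O) (F := F) w
  refine lemM w.valuation D (decomp_closed w) φ ?_ ?_ ?_ ?_ ?_ ?_
  · -- continuity
    apply continuous_of_continuousAt_one
    rw [ContinuousAt, map_one]
    intro U hU
    rw [krullTopology_mem_nhds_one_iff] at hU
    obtain ⟨L, hL, hLU⟩ := hU
    obtain ⟨S, hS⟩ := IntermediateField.fg_of_fg_toSubalgebra L
      (Subalgebra.fg_of_fg_toSubmodule (Module.Finite.iff_fg.1 hL))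
    choose b hb using fun x : K => hsurj (algebraMap K (ResidueField w) x)
    have hopen : IsOpen (⋂ x ∈ S, ((MulAction.stabilizer (E ≃ₐ[F] E) (b x : E) :
        Subgroup (E ≃ₐ[F] E)) : Set (E ≃ₐ[F] E))) :=
      isOpen_biInter_finset fun x _ => stabilizer_isOpen_of_isIntegral (K := F) _
    have hopen' := hopen.preimage (continuous_subtype_val (p := fun g => g ∈ D))
    rw [Filter.mem_map]
    refine Filter.mem_of_superset (hopen'.mem_nhds ?_) ?_
    · simp only [Set.mem_preimage, Set.mem_iInter]
      intro x _
      exact one_mem _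
    · intro d hd
      apply hLU
      simp only [Set.mem_preimage, Set.mem_iInter] at hd
      rw [SetLike.mem_coe, IntermediateField.mem_fixingSubgroup_iff]
      have hfix : ∀ x ∈ S, φ d x = x := by
        intro x hx
        have h1 : (d : E ≃ₐ[F] E) (b x : E) = b x := hd x hx
        apply (algebraMap K (ResidueField w)).injective
        change algebraMap K (ResidueField w) (ρ (actD w d) x) = _
        rw [hρc, ← hb, piB_apply, actD_residue (h := by
          change (d : E ≃ₐ[F] E) (b x : E) ∈ w
          rw [h1]; exact int_mem w (b x).2)]
        congr 1
        exact Subtype.ext h1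
      have hle : L ≤ IntermediateField.fixedField (Subgroup.zpowers (φ d)) := by
        rw [← hS, IntermediateField.adjoin_le_iff]
        intro x hx
        rw [SetLike.mem_coe, IntermediateField.mem_fixedField_iff]
        intro f hf
        have : Subgroup.zpowers (φ d) ≤ MulAction.stabilizer (K ≃ₐ[ResidueField O] K) x := by
          rw [Subgroup.zpowers_le]
          exact hfix x hx
        exact this hf
      intro x hx
      exact (IntermediateField.mem_fixedField_iff _ _).1 (hle hx) _ (Subgroup.mem_zpowers _)
  · -- surjectivity
    intro γ
    obtain ⟨τ, rfl⟩ := hρs γ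
    obtain ⟨d, -, hd⟩ := lemS' (F := F) w ⊤ isClosed_univ τ (by
      intro b hb
      have h1 : (b : E) ∈ Set.range (algebraMap F E) := by
        rw [InfiniteGalois.mem_range_algebraMap_iff_fixed]
        intro f
        exact hb f trivial
      obtain ⟨a, ha⟩ := h1
      have h2 : IsIntegral O a := by
        have := b.2
        change IsIntegral O (b : E) at this
        rw [← ha] at this
        exact (isIntegral_algebraMap_iff (algebraMap F E).injective).1 this
      obtain ⟨o, rfl⟩ := IsIntegrallyClosed.isIntegral_iff.1 h2
      have h3 : piB w b = algebraMap (ResidueField O) (ResidueField w) (residue O o) := by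
        rw [piB_apply, ResidueField.algebraMap_residue]
        congr 1
        apply Subtype.ext
        change (b : E) = algebraMap w E (algebraMap O w o)
        rw [← ha, ← IsScalarTower.algebraMap_apply, ← IsScalarTower.algebraMap_apply]
      rw [h3, AlgEquiv.commutes])
    exact ⟨d, (hφ d τ).2 hd⟩
  · -- R0
    intro d hd x
    exact decomp_val w d hd x
  · -- R1
    intro d hd x hx
    have h1 : actD (O := O) w d = 1 := (hφ d 1).1 (by rw [hd, map_one])
    have hx' : x ∈ w := (w.valuation_le_one_iff x).1 hx
    have hdx : (d : E ≃ₐ[F] E) x ∈ w := ((mem_decomp_iff w _).1 d.2 x).2 hx'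
    have h2 := actD_residue (O := O) w d ⟨x, hx'⟩ hdx
    rw [h1, AlgEquiv.one_apply] at h2
    have h3 : residue w (⟨(d : E ≃ₐ[F] E) x, hdx⟩ - ⟨x, hx'⟩) = 0 := by
      rw [map_sub, ← h2, sub_self]
    exact (residue_eq_zero_iff_val w _).1 h3
  · -- R2
    intro C hC hCD h γ
    obtain ⟨τ, rfl⟩ := hρs γ
    obtain ⟨d, hdC, hd⟩ := lemS' (F := F) w C hC τ (by
      intro b hb
      have hbw : (b : E) ∈ w := int_mem w b.2
      obtain ⟨d, hd, hdb⟩ := h b ((w.valuation_le_one_iff _).2 hbw) hb (ρ τ)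
      have hdw : (d : E ≃ₐ[F] E) b ∈ w := ((mem_decomp_iff w _).1 d.2 _).2 hbw
      rw [hφ] at hd
      rw [← hd, piB_apply, actD_residue (h := hdw), ← sub_eq_zero, ← map_sub,
        residue_eq_zero_iff_val]
      exact hdb)
    exact ⟨d, hdC, (hφ d τ).2 hd⟩
  · -- R3
    intro n
    have h1 := residue_eq_zero_iff_val w (n : w)
    have h2 : (((n : w) : E)) = (n : E) := by simp
    rw [h2] at h1
    rw [← h1, map_natCast, ← map_natCast (algebraMap (ResidueField O) (ResidueField w)),
      map_eq_zero]

theorem final_aux (F : Type*) [Field F] (A : ValuationSubring F) (E : Type*) [Field E] [Algebra F E]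
    [IsGalois F E] [IsSepClosed E] {K : Type*} [Field K] [Algebra (ResidueField A) K]
    [IsGalois (ResidueField A) K] [IsSepClosed K] :
    ∃ ψ : (K ≃ₐ[ResidueField A] K) →* (E ≃ₐ[F] E), Continuous ψ ∧ Function.Injective ψ := by
  let f : A →+* E := (algebraMap F E).comp (algebraMap A F)
  obtain ⟨w, h, hloc⟩ := IsLocalRing.exists_factor_valuationRing f
  let _ : Algebra A E := f.toAlgebra
  have : IsScalarTower A F E := IsScalarTower.of_algebraMap_eq fun _ => rfl
  let _ : Algebra A w := (f.codRestrict w.toSubring h).toAlgebra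
  have : IsScalarTower A w E := IsScalarTower.of_algebraMap_eq fun _ => rfl
  have : IsLocalHom (algebraMap A w) := hloc
  exact mainM w

end P9

theorem stmt11 (F : Type) [Field F] {Γ : Type} [LinearOrderedCommGroupWithZero Γ]
    (v : Valuation F Γ) :
    ∀ H : Subgroup (AbsGal (IsLocalRing.ResidueField ↥v.valuationSubring)),
      IsClosed (H : Set (AbsGal (IsLocalRing.ResidueField ↥v.valuationSubring))) →
      ∃ H' : Subgroup (AbsGal F), IsClosed (H' : Set (AbsGal F)) ∧
        ∃ e : ↥H ≃* ↥H', Continuous e ∧ Continuous e.symm := by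
  intro H hH
  have : IsSepClosed (separableClosure F (AlgebraicClosure F)) :=
    IsSepClosure.sep_closed F
  have : IsSepClosed (separableClosure (IsLocalRing.ResidueField ↥v.valuationSubring)
      (AlgebraicClosure (IsLocalRing.ResidueField ↥v.valuationSubring))) :=
    IsSepClosure.sep_closed (IsLocalRing.ResidueField ↥v.valuationSubring)
  obtain ⟨ψ, hψ, hinj⟩ := final_aux F v.valuationSubring (separableClosure F (AlgebraicClosure F))
    (K := separableClosure (IsLocalRing.ResidueField ↥v.valuationSubring)
      (AlgebraicClosure (IsLocalRing.ResidueField ↥v.valuationSubring)))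
  refine ⟨H.map ψ, ?_, H.equivMapOfInjective ψ hinj, ?_, ?_⟩
  · rw [Subgroup.coe_map]
    exact (hH.isCompact.image hψ).isClosed
  · exact Continuous.subtype_mk (hψ.comp continuous_subtype_val) _
  · have : CompactSpace H := isCompact_iff_compactSpace.1 hH.isCompact
    exact Continuous.continuous_symm_of_equiv_compact_to_t2
      (f := (H.equivMapOfInjective ψ hinj).toEquiv)
      (Continuous.subtype_mk (hψ.comp continuous_subtype_val) _)
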